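/- (Concavity of the solution operator) Let F : ℝᴺ × S(N) → ℝ be a continuous function satisfying, for some constant C > 0: λ F(p, Y) ≤ C F(λp, λY) for all λ ≥ 0, and |F(p, X) − F(q, Y)| ≤ C(|p − q| + ‖X − Y‖). Assume F is monotone in X (F(p, X) ≥ F(p, Y) whenever X ≥ Y) and concave: for each α ∈ (0, 1), α F(p, X) + (1 − α) F(q, Y) ≤ F(αp + (1 − α)q, αX + (1 − α)Y) for all p, q ∈ ℝᴺ and X, Y ∈ S(N). Let v_1, v_2 be upper semicontinuous viscosity subsolutions of ∂_t v − F(Dv, D²v) = 0 on (0, T) × ℝᴺ and let v be a lower semicontinuous viscosity supersolution of ∂_t v − F(Dv, D²v) = 0 on (0, T) × ℝᴺ (all of polynomial growth), such that α v_1(0, ·) + (1 − α) v_2(0, ·) − v(0, ·) is a non-positive continuous function. Then α v_1(t, ·) + (1 − α) v_2(t, ·) ≤ v(t, ·) for all t ≥ 0 within the time horizon. -/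

import Mathlib

noncomputable section

open Real Set Filter

/-- `ℝᴺ` as a Euclidean space. -/
abbrev Euc (N : ℕ) := EuclideanSpace ℝ (Fin N)

/-- Time derivative `∂ₜψ` of a function on `ℝ × ℝᴺ`. -/
noncomputable def tderiv {N : ℕ} (ψ : ℝ × Euc N → ℝ) (q : ℝ × Euc N) : ℝ :=
  deriv (fun s => ψ (s, q.2)) q.1

/-- Spatial gradient `Dψ` of a function on `ℝ × ℝᴺ`. -/
noncomputable def xgrad {N : ℕ} (ψ : ℝ × Euc N → ℝ) (q : ℝ × Euc N) : Euc N :=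
  gradient (fun z => ψ (q.1, z)) q.2

/-- Spatial Hessian `D²ψ` (as a matrix) of a function on `ℝ × ℝᴺ`. -/
noncomputable def xhess {N : ℕ} (ψ : ℝ × Euc N → ℝ) (q : ℝ × Euc N) :
    Matrix (Fin N) (Fin N) ℝ :=
  fun i j => iteratedFDeriv ℝ 2 (fun z => ψ (q.1, z)) q.2
    ![EuclideanSpace.single i 1, EuclideanSpace.single j 1]

/-- The operator norm of a matrix, acting on Euclidean space. -/
noncomputable def matOpNorm {N : ℕ} (A : Matrix (Fin N) (Fin N) ℝ) : ℝ :=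
  ‖(Matrix.toEuclideanCLM (𝕜 := ℝ) A : Euc N →L[ℝ] Euc N)‖

/-- `u` is a viscosity subsolution of `∂ₜu − G(u, Du, D²u) = 0` on `(0,T) × ℝᴺ`. -/
def IsViscSubsol {N : ℕ} (T : ℝ)
    (G : ℝ → Euc N → Matrix (Fin N) (Fin N) ℝ → ℝ)
    (u : ℝ × Euc N → ℝ) : Prop :=
  ∀ ψ : ℝ × Euc N → ℝ, ContDiff ℝ 2 ψ →
    ∀ q : ℝ × Euc N, q.1 ∈ Set.Ioo 0 T →
    IsLocalMaxOn (fun z => u z - ψ z)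
      (Set.Ioo (0 : ℝ) T ×ˢ (Set.univ : Set (Euc N))) q →
    tderiv ψ q - G (u q) (xgrad ψ q) (xhess ψ q) ≤ 0

/-- `v` is a viscosity supersolution of `∂ₜv − F(Dv, D²v) = 0` on `(0,T) × ℝᴺ`. -/
def IsViscSupersol' {N : ℕ} (T : ℝ)
    (F : Euc N → Matrix (Fin N) (Fin N) ℝ → ℝ)
    (v : ℝ × Euc N → ℝ) : Prop :=
  ∀ ψ : ℝ × Euc N → ℝ, ContDiff ℝ 2 ψ →
    ∀ q : ℝ × Euc N, q.1 ∈ Set.Ioo 0 T →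
    IsLocalMinOn (fun z => v z - ψ z)
      (Set.Ioo (0 : ℝ) T ×ˢ (Set.univ : Set (Euc N))) q →
    0 ≤ tderiv ψ q - F (xgrad ψ q) (xhess ψ q)

/-- `u` is a viscosity subsolution of `∂ₜu − F(Du, D²u) = 0` on `(0,T) × ℝᴺ`. -/
def IsViscSubsol' {N : ℕ} (T : ℝ)
    (F : Euc N → Matrix (Fin N) (Fin N) ℝ → ℝ)
    (u : ℝ × Euc N → ℝ) : Prop :=
  ∀ ψ : ℝ × Euc N → ℝ, ContDiff ℝ 2 ψ →
    ∀ q : ℝ × Euc N, q.1 ∈ Set.Ioo 0 T →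
    IsLocalMaxOn (fun z => u z - ψ z)
      (Set.Ioo (0 : ℝ) T ×ˢ (Set.univ : Set (Euc N))) q →
    tderiv ψ q - F (xgrad ψ q) (xhess ψ q) ≤ 0

/-- Polynomial growth of a function on `[0,T] × ℝᴺ`. -/
def PolyGrowth {N : ℕ} (T : ℝ) (u : ℝ × Euc N → ℝ) : Prop :=
  ∃ (C : ℝ) (k : ℕ), ∀ t ∈ Set.Icc (0 : ℝ) T, ∀ x : Euc N,
    |u (t, x)| ≤ C * (1 + ‖x‖ ^ k)

set_option linter.unusedSectionVars false
set_option linter.style.haveILetI false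
open scoped Topology NNReal ENNReal

section TheoremOnSums

variable {H : Type*} [NormedAddCommGroup H] [InnerProductSpace ℝ H] [FiniteDimensional ℝ H]

/-- Density points: near almost every point of `S`, the set `S` is `o(r)`-dense. -/
lemma vs_density [MeasurableSpace H] [BorelSpace H] (μ : MeasureTheory.Measure H)
    [μ.IsAddHaarMeasure] (S : Set H) :
    ∀ᵐ z ∂μ.restrict S, ∀ m : ℕ, ∀ᶠ y in 𝓝[≠] z, ∃ y' ∈ S, ‖y - y'‖ ≤ (1 / (m + 1 : ℝ)) * ‖y - z‖ := by
  rw [MeasureTheory.ae_all_iff]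
  intro m
  filter_upwards [IsUnifLocDoublingMeasure.ae_tendsto_measure_inter_div μ S ((m : ℝ) + 1)] with z hz
  have hm : (0 : ℝ) < m + 1 := by positivity
  have h1 : Tendsto (fun y : H => (1 / (m + 1 : ℝ)) * ‖y - z‖) (𝓝[≠] z) (𝓝[>] 0) := by
    rw [tendsto_nhdsWithin_iff]
    constructor
    · have : Continuous (fun y : H => (1 / (m + 1 : ℝ)) * ‖y - z‖) := by fun_prop
      have := this.tendsto z
      simp only [sub_self, norm_zero, mul_zero] at this
      exact this.mono_left nhdsWithin_le_nhds
    · filter_upwards [self_mem_nhdsWithin] with y hy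
      have : 0 < ‖y - z‖ := norm_pos_iff.2 (sub_ne_zero.2 hy)
      simp only [mem_Ioi]; positivity
  have h2 := hz (fun y : H => y) _ h1 (by
    refine Eventually.of_forall fun y => ?_
    rw [Metric.mem_closedBall, dist_comm, dist_eq_norm]
    apply le_of_eq; field_simp)
  filter_upwards [(tendsto_order.1 h2).1 0 zero_lt_one] with y hy
  have : μ (S ∩ Metric.closedBall y (1 / (m + 1 : ℝ) * ‖y - z‖)) ≠ 0 := by
    intro h; rw [h] at hy; simp at hy
  obtain ⟨y', h1, h2⟩ := MeasureTheory.nonempty_of_measure_ne_zero this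
  refine ⟨y', h1, ?_⟩
  rwa [Metric.mem_closedBall, dist_comm, dist_eq_norm] at h2

/-- A function on `[0,1]` with small two-sided slopes up to quadratic errors varies little. -/
lemma vs_telescope (e : ℝ → ℝ) (ε c : ℝ) (hc : 0 ≤ c) (h : ∀ s ∈ Icc (0:ℝ) 1, ∀ t ∈ Icc (0:ℝ) 1,
    e s - ε * |t - s| - c * |t - s| ^ 2 ≤ e t) : |e 1 - e 0| ≤ ε := by
  have key : ∀ m : ℕ, |e 1 - e 0| ≤ ε + c / (m + 1) := by
    intro m
    have hm : (0 : ℝ) < m + 1 := by positivity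
    have h1 : ∀ j : ℕ, j ≤ m + 1 → |e (j / (m + 1)) - e 0| ≤ j * (ε / (m + 1) + c / (m + 1) ^ 2) := by
      intro j
      induction j with
      | zero => intro _; simp
      | succ j ih =>
        intro hj
        have ih := ih (by omega)
        have hj' : (j : ℝ) + 1 ≤ m + 1 := by exact_mod_cast hj
        have a1 : (j : ℝ) / (m + 1) ∈ Icc (0:ℝ) 1 :=
          ⟨by positivity, by rw [div_le_one hm]; linarith⟩
        have a2 : ((j + 1 : ℕ) : ℝ) / (m + 1) ∈ Icc (0:ℝ) 1 :=
          ⟨by positivity, by rw [div_le_one hm]; push_cast; linarith⟩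
        have b1 := h _ a1 _ a2
        have b2 := h _ a2 _ a1
        have d : ((j + 1 : ℕ) : ℝ) / (m + 1) - (j : ℝ) / (m + 1) = 1 / (m + 1) := by
          push_cast; field_simp; ring
        have d1 : |((j + 1 : ℕ) : ℝ) / (m + 1) - (j : ℝ) / (m + 1)| = 1 / (m + 1) := by
          rw [d, abs_of_pos (by positivity)]
        have d2 : |(j : ℝ) / (m + 1) - ((j + 1 : ℕ) : ℝ) / (m + 1)| = 1 / (m + 1) := by
          rw [abs_sub_comm, d1]
        rw [d1] at b1
        rw [d2] at b2
        have e1 : ε * (1 / (m + 1 : ℝ)) = ε / (m + 1) := by ring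
        have e2 : c * (1 / (m + 1 : ℝ)) ^ 2 = c / (m + 1) ^ 2 := by rw [div_pow, one_pow, mul_one_div]
        rw [e1, e2] at b1 b2
        rw [abs_le] at ih ⊢
        push_cast at *
        constructor <;> nlinarith
    have h2 := h1 (m + 1) le_rfl
    have h3 : (((m + 1 : ℕ) : ℝ)) / (m + 1) = 1 := by push_cast; field_simp
    rw [h3] at h2
    refine h2.trans (le_of_eq ?_)
    push_cast; field_simp
  have hl : Tendsto (fun m : ℕ => ε + c / ((m : ℝ) + 1)) atTop (𝓝 (ε + 0)) := by
    apply Tendsto.const_add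
    have := (tendsto_one_div_add_atTop_nhds_zero_nat (𝕜 := ℝ)).const_mul c
    simpa [div_eq_mul_inv] using this
  rw [add_zero] at hl
  exact ge_of_tendsto' hl key

open scoped RealInnerProductSpace

/-- Subgradients are Lipschitz at points touched from both sides. -/
lemma vs_lip (u : H → ℝ) (c : ℝ) (hc : 0 ≤ c) (x z qx qz : H)
    (hx : ∀ y, u x + ⟪qx, y - x⟫ - c * ‖y - x‖ ^ 2 ≤ u y)
    (hz : ∀ y, u z + ⟪qz, y - z⟫ - c * ‖y - z‖ ^ 2 ≤ u y)
    (hz' : ∀ y, u y ≤ u z + ⟪qz, y - z⟫ + c * ‖y - z‖ ^ 2) :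
    ‖qx - qz‖ ≤ 6 * c * ‖x - z‖ := by
  by_cases h0 : qx - qz = 0
  · rw [h0, norm_zero]; positivity
  have hn : 0 < ‖qx - qz‖ := norm_pos_iff.2 h0
  by_cases hxz : x = z
  · exfalso
    subst hxz
    -- test with y = x + s (qx - qz)
    have key : ∀ s : ℝ, 0 < s → ‖qx - qz‖ ^ 2 ≤ 2 * c * s * ‖qx - qz‖ ^ 2 := by
      intro s hs
      have h1 := hx (x + s • (qx - qz))
      have h2 := hz' (x + s • (qx - qz))
      simp only [add_sub_cancel_left, inner_smul_right, norm_smul, Real.norm_eq_abs,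
        abs_of_pos hs] at h1 h2
      have h3 : ⟪qx, qx - qz⟫ - ⟪qz, qx - qz⟫ = ‖qx - qz‖ ^ 2 := by
        rw [← inner_sub_left, real_inner_self_eq_norm_sq]
      have h4 : s * ‖qx - qz‖ ^ 2 ≤ s * (2 * c * s * ‖qx - qz‖ ^ 2) := by
        rw [mul_pow] at h1 h2
        nlinarith
      exact le_of_mul_le_mul_left h4 hs
    have h5 := key (1 / (4 * (c + 1))) (by positivity)
    have h6 : 2 * c * (1 / (4 * (c + 1))) ≤ 1 / 2 := by
      rw [mul_one_div, div_le_div_iff₀ (by positivity) (by positivity)]; linarith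
    nlinarith [sq_nonneg ‖qx - qz‖, pow_pos hn 2]
  · have hr : 0 < ‖x - z‖ := norm_pos_iff.2 (sub_ne_zero.2 hxz)
    set r := ‖x - z‖
    set d := qx - qz with hd
    set e : H := (r / ‖d‖) • d with he
    have hne : ‖e‖ = r := by
      rw [he, norm_smul, Real.norm_eq_abs, abs_of_pos (by positivity)]; field_simp
    have h1 := hx (x + e)
    have h2 := hz' (x + e)
    have h3 := hz x
    rw [add_sub_cancel_left, hne] at h1
    have h4 : x + e - z = (x - z) + e := by abel
    rw [h4, inner_add_right] at h2
    have h5 : ‖(x - z) + e‖ ^ 2 ≤ 4 * r ^ 2 := by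
      have := norm_add_le (x - z) e
      rw [hne] at this
      have h7 : 0 ≤ ‖(x - z) + e‖ := norm_nonneg _
      have h8 : ‖(x - z) + e‖ ≤ 2 * r := by simpa [two_mul] using this
      nlinarith
    have h6 : ⟪qx, e⟫ - ⟪qz, e⟫ = r * ‖d‖ := by
      rw [← inner_sub_left, ← hd, he, inner_smul_right, real_inner_self_eq_norm_sq]; field_simp
    have h9 : r * ‖d‖ ≤ r * (6 * c * r) := by
      have : c * ‖(x - z) + e‖ ^ 2 ≤ c * (4 * r ^ 2) := by gcongr
      nlinarith
    exact le_of_mul_le_mul_left h9 hr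

/-- If the subgradients have a first order expansion at `z`, then `u` has a second order one. -/
lemma vs_expand (u : H → ℝ) (q : H → H) (c : ℝ) (hc : 0 ≤ c)
    (hq : ∀ x y, u x + ⟪q x, y - x⟫ - c * ‖y - x‖ ^ 2 ≤ u y) (z : H) (A : H →L[ℝ] H)
    (hA : ∀ ε > 0, ∀ᶠ x in 𝓝 z, ‖q x - q z - A (x - z)‖ ≤ ε * ‖x - z‖) :
    ∀ ε > 0, ∀ᶠ y in 𝓝 z,
      |u y - u z - ⟪q z, y - z⟫ - 1 / 2 * ⟪A (y - z), y - z⟫| ≤ ε * ‖y - z‖ ^ 2 := by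
  intro ε hε
  obtain ⟨ρ, hρ, h⟩ := Metric.eventually_nhds_iff.1 (hA ε hε)
  rw [Metric.eventually_nhds_iff]
  refine ⟨ρ, hρ, fun y hy => ?_⟩
  set k := y - z with hk
  set a := ⟪q z, k⟫ with ha
  set b := ⟪A k, k⟫ with hb
  have hcc : 0 ≤ c * ‖k‖ ^ 2 + |b| := by positivity
  have key := vs_telescope (fun s => u (z + s • k) - s * a - s ^ 2 / 2 * b) (ε * ‖k‖ ^ 2)
    (c * ‖k‖ ^ 2 + |b|) hcc (by
      intro s hs t ht
      have h1 := hq (z + s • k) (z + t • k)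
      have e1 : z + t • k - (z + s • k) = (t - s) • k := by rw [sub_smul]; abel
      rw [e1, inner_smul_right, norm_smul, mul_pow, Real.norm_eq_abs] at h1
      have h2 : ‖q (z + s • k) - q z - A (z + s • k - z)‖ ≤ ε * ‖z + s • k - z‖ := by
        apply h
        rw [dist_eq_norm, add_sub_cancel_left, norm_smul, Real.norm_eq_abs, abs_of_nonneg hs.1]
        rw [dist_eq_norm] at hy
        have := mul_le_mul_of_nonneg_right hs.2 (norm_nonneg k)
        rw [one_mul] at this
        exact this.trans_lt hy
      rw [add_sub_cancel_left, norm_smul, Real.norm_eq_abs, abs_of_nonneg hs.1, map_smul] at h2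
      have h3 : |⟪q (z + s • k), k⟫ - a - s * b| ≤ ε * ‖k‖ ^ 2 := by
        have e2 : ⟪q (z + s • k), k⟫ - a - s * b = ⟪q (z + s • k) - q z - s • A k, k⟫ := by
          rw [inner_sub_left, inner_sub_left, inner_smul_left]; simp [ha, hb]
        rw [e2]
        refine (abs_real_inner_le_norm _ _).trans ?_
        have h4 : s * ‖k‖ ≤ ‖k‖ := by
          have := mul_le_mul_of_nonneg_right hs.2 (norm_nonneg k); rwa [one_mul] at this
        calc _ ≤ (ε * (s * ‖k‖)) * ‖k‖ := by gcongr
          _ ≤ (ε * ‖k‖) * ‖k‖ := by gcongr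
          _ = _ := by ring
      have h5 : -(|t - s| * (ε * ‖k‖ ^ 2)) ≤ (t - s) * (⟪q (z + s • k), k⟫ - a - s * b) := by
        refine le_trans ?_ (neg_abs_le _)
        rw [abs_mul]
        have := mul_le_mul_of_nonneg_left h3 (abs_nonneg (t - s))
        linarith
      have h6 : (t - s) ^ 2 / 2 * b ≤ |b| * |t - s| ^ 2 := by
        rw [sq_abs]
        nlinarith [le_abs_self b, sq_nonneg (t - s), abs_nonneg b]
      nlinarith)
  simp only [one_smul, zero_smul, add_zero] at key
  have e3 : z + k = y := by rw [hk]; abel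
  rw [e3] at key
  refine le_trans (le_of_eq ?_) key
  congr 1; ring

/-- Core of the theorem on sums: Jensen's lemma together with second order differentiability. -/
lemma vs_jensen {ι : Type*} [Fintype ι] (u : ι → H → ℝ) (q : ι → H → H) (c₀ : ℝ) (hc₀ : 0 ≤ c₀)
    (hq₀ : ∀ i x y, u i x + ⟪q i x, y - x⟫ - c₀ * ‖y - x‖ ^ 2 ≤ u i y) (δ : ℝ) (hδ : 0 < δ)
    (hmax : ∀ p : H, ‖p‖ ≤ δ → ∃ z, ∀ y, ∑ i, u i y ≤ ∑ i, u i z + ⟪p, y - z⟫) :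
    ∃ (z : H) (A : ι → H →L[ℝ] H), ‖∑ i, q i z‖ ≤ δ ∧
      (∀ y, ∑ i, u i y ≤ ∑ i, u i z + ⟪∑ i, q i z, y - z⟫) ∧
      (∀ k, ∑ i, ⟪A i k, k⟫ ≤ 0) ∧
      ∀ i, ∀ ε > 0, ∀ᶠ y in 𝓝 z,
        |u i y - u i z - ⟪q i z, y - z⟫ - 1 / 2 * ⟪A i (y - z), y - z⟫| ≤ ε * ‖y - z‖ ^ 2 := by
  classical
  letI : MeasurableSpace H := borel H
  haveI : BorelSpace H := ⟨rfl⟩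
  set μ : MeasureTheory.Measure H := MeasureTheory.Measure.hausdorffMeasure (Module.finrank ℝ H : ℝ)
    with hμ
  set c : ℝ := c₀ * (Fintype.card ι + 1) with hcdef
  have hc : 0 ≤ c := by positivity
  have hcc : c₀ ≤ c := by
    rw [hcdef]; nlinarith [(Nat.cast_nonneg (Fintype.card ι) : (0 : ℝ) ≤ _)]
  have hq : ∀ i x y, u i x + ⟪q i x, y - x⟫ - c * ‖y - x‖ ^ 2 ≤ u i y := by
    intro i x y
    have := hq₀ i x y
    have h2 : c₀ * ‖y - x‖ ^ 2 ≤ c * ‖y - x‖ ^ 2 := by gcongr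
    linarith
  -- the sum of the lower bounds
  have hsumlow : ∀ x y, ∑ i, u i x + ⟪∑ i, q i x, y - x⟫ - c * ‖y - x‖ ^ 2 ≤ ∑ i, u i y := by
    intro x y
    have h1 : ∑ i, (u i x + ⟪q i x, y - x⟫ - c₀ * ‖y - x‖ ^ 2) ≤ ∑ i, u i y :=
      Finset.sum_le_sum fun i _ => hq₀ i x y
    rw [Finset.sum_sub_distrib, Finset.sum_add_distrib, ← sum_inner, Finset.sum_const,
      Finset.card_univ, nsmul_eq_mul] at h1
    have h2 : 0 ≤ c₀ * ‖y - x‖ ^ 2 := by positivity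
    rw [hcdef]
    nlinarith
  set K : Set H := {z | ‖∑ i, q i z‖ ≤ δ ∧ ∀ y, ∑ i, u i y ≤ ∑ i, u i z + ⟪∑ i, q i z, y - z⟫}
    with hK
  -- any slope touching from above is the sum of the subgradients
  have hslope : ∀ p z, (∀ y, ∑ i, u i y ≤ ∑ i, u i z + ⟪p, y - z⟫) → p = ∑ i, q i z := by
    intro p z hp
    have := vs_lip (fun y => ∑ i, u i y) c hc z z (∑ i, q i z) p (hsumlow z) ?_ ?_
    · rw [sub_self, norm_zero, mul_zero] at this
      exact (sub_eq_zero.1 (norm_le_zero_iff.1 this)).symm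
    · -- p is also a subgradient slope; derive by comparison of slopes
      have hd : ∀ y, ⟪(∑ i, q i z) - p, y⟫ ≤ c * ‖y‖ ^ 2 := by
        intro y
        have h1 := hsumlow z (z + y)
        have h2 := hp (z + y)
        rw [add_sub_cancel_left] at h1 h2
        rw [inner_sub_left]; linarith
      have hzero : (∑ i, q i z) - p = 0 := by
        by_contra hne
        have hpos : 0 < ‖(∑ i, q i z) - p‖ := norm_pos_iff.2 hne
        have h3 := hd ((1 / (2 * (c + 1))) • ((∑ i, q i z) - p))
        rw [inner_smul_right, real_inner_self_eq_norm_sq, norm_smul, mul_pow, Real.norm_eq_abs,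
          sq_abs] at h3
        have h4 : c * (1 / (2 * (c + 1))) ^ 2 < 1 / (2 * (c + 1)) := by
          have : c * (1 / (2 * (c + 1))) < 1 := by
            rw [mul_one_div, div_lt_one (by positivity)]; linarith
          have h5 : 0 < 1 / (2 * (c + 1)) := by positivity
          nlinarith
        nlinarith [pow_pos hpos 2]
      rw [← sub_eq_zero.1 hzero]
      exact hsumlow z
    · intro y
      have := hp y
      have h2 : 0 ≤ c * ‖y - z‖ ^ 2 := by positivity
      linarith
  -- upper paraboloids on K
  have hup : ∀ i, ∀ z ∈ K, ∀ y, u i y ≤ u i z + ⟪q i z, y - z⟫ + c * ‖y - z‖ ^ 2 := by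
    intro i z hz y
    have h1 := hz.2 y
    have h2 : ∑ j ∈ Finset.univ.erase i, (u j z + ⟪q j z, y - z⟫ - c₀ * ‖y - z‖ ^ 2)
        ≤ ∑ j ∈ Finset.univ.erase i, u j y := Finset.sum_le_sum fun j _ => hq₀ j z y
    rw [Finset.sum_sub_distrib, Finset.sum_add_distrib, ← sum_inner, Finset.sum_const,
      nsmul_eq_mul] at h2
    rw [← Finset.add_sum_erase _ (fun j => u j y) (Finset.mem_univ i),
      ← Finset.add_sum_erase _ (fun j => u j z) (Finset.mem_univ i),
      ← Finset.add_sum_erase _ (fun j => q j z) (Finset.mem_univ i), inner_add_left] at h1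
    have h3 : ((Finset.univ.erase i).card : ℝ) ≤ Fintype.card ι + 1 := by
      have : (Finset.univ.erase i).card ≤ Fintype.card ι := Finset.card_le_univ _
      have : ((Finset.univ.erase i).card : ℝ) ≤ Fintype.card ι := by exact_mod_cast this
      linarith
    have h4 : ((Finset.univ.erase i).card : ℝ) * (c₀ * ‖y - z‖ ^ 2) ≤ c * ‖y - z‖ ^ 2 := by
      rw [hcdef]
      have : 0 ≤ c₀ * ‖y - z‖ ^ 2 := by positivity
      nlinarith
    linarith
  have hL : ∀ i, ∀ z ∈ K, ∀ x, ‖q i x - q i z‖ ≤ 6 * c * ‖x - z‖ := fun i z hz x =>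
    vs_lip (u i) c hc x z _ _ (hq i x) (hq i z) (hup i z hz)
  have hLs : ∀ z ∈ K, ∀ x, ‖∑ i, q i x - ∑ i, q i z‖ ≤ 6 * c * ‖x - z‖ := by
    intro z hz x
    refine vs_lip (fun y => ∑ i, u i y) c hc x z _ _ (hsumlow x) (hsumlow z) fun y => ?_
    have := hz.2 y
    have h2 : 0 ≤ c * ‖y - z‖ ^ 2 := by positivity
    linarith
  -- K is closed
  have hKc : IsClosed K := by
    rw [← isSeqClosed_iff_isClosed]
    intro s z hs hz
    have hq' : Tendsto (fun n => ∑ i, q i (s n)) atTop (𝓝 (∑ i, q i z)) := by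
      rw [tendsto_iff_norm_sub_tendsto_zero]
      have h0 : Tendsto (fun n => 6 * c * ‖z - s n‖) atTop (𝓝 0) := by
        have : Tendsto (fun n => 6 * c * ‖z - s n‖) atTop (𝓝 (6 * c * ‖z - z‖)) :=
          ((tendsto_const_nhds.sub hz).norm).const_mul _
        simpa using this
      refine squeeze_zero (fun _ => norm_nonneg _) (fun n => ?_) h0
      rw [norm_sub_rev]
      exact hLs _ (hs n) z
    refine ⟨le_of_tendsto' hq'.norm fun n => (hs n).1, fun y => ?_⟩
    have h1 : ∀ n, ∑ i, u i y ≤ ∑ i, u i z - ⟪∑ i, q i (s n), z - s n⟫ + c * ‖z - s n‖ ^ 2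
        + ⟪∑ i, q i (s n), y - s n⟫ := by
      intro n
      have h1 := (hs n).2 y
      have h2 := hsumlow (s n) z
      linarith
    have h2 : Tendsto (fun n => ∑ i, u i z - ⟪∑ i, q i (s n), z - s n⟫ + c * ‖z - s n‖ ^ 2
        + ⟪∑ i, q i (s n), y - s n⟫) atTop (𝓝 (∑ i, u i z - ⟪∑ i, q i z, z - z⟫ + c * ‖z - z‖ ^ 2
        + ⟪∑ i, q i z, y - z⟫)) := by
      have hz1 : Tendsto (fun n => z - s n) atTop (𝓝 (z - z)) := tendsto_const_nhds.sub hz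
      have hz2 : Tendsto (fun n => y - s n) atTop (𝓝 (y - z)) := tendsto_const_nhds.sub hz
      exact ((tendsto_const_nhds.sub (hq'.inner hz1)).add ((hz1.norm.pow 2).const_mul c)).add
        (hq'.inner hz2)
    have h3 := ge_of_tendsto' h2 h1
    simpa using h3
  -- K has positive measure
  have hKpos : μ K ≠ 0 := by
    intro h0
    have hlipK : LipschitzOnWith (Real.toNNReal (6 * c)) (fun z => ∑ i, q i z) K := by
      refine LipschitzOnWith.of_dist_le_mul fun x _ z hz => ?_
      rw [dist_eq_norm, dist_eq_norm, Real.coe_toNNReal _ (by positivity)]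
      exact hLs z hz x
    have h1 := hlipK.hausdorffMeasure_image_le (d := (Module.finrank ℝ H : ℝ)) (by positivity)
    rw [← hμ, h0, mul_zero] at h1
    have h2 : Metric.closedBall (0 : H) δ ⊆ (fun z => ∑ i, q i z) '' K := by
      intro p hp
      rw [mem_closedBall_zero_iff] at hp
      obtain ⟨z, hz⟩ := hmax p hp
      have h3 := hslope p z hz
      refine ⟨z, ⟨h3 ▸ hp, h3 ▸ hz⟩, h3.symm⟩
    have h3 : 0 < μ (Metric.closedBall (0 : H) δ) := Metric.measure_closedBall_pos μ _ hδ
    exact absurd ((MeasureTheory.measure_mono h2).trans h1) (not_le.2 h3)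
  -- extend and differentiate
  have hext : ∀ i, ∃ g : H → H, (∃ L, LipschitzWith L g) ∧ EqOn (q i) g K := by
    intro i
    have hlipK : LipschitzOnWith (Real.toNNReal (6 * c)) (q i) K := by
      refine LipschitzOnWith.of_dist_le_mul fun x _ z hz => ?_
      rw [dist_eq_norm, dist_eq_norm, Real.coe_toNNReal _ (by positivity)]
      exact hL i z hz x
    obtain ⟨g, hg, hg'⟩ := hlipK.extend_finite_dimension
    exact ⟨g, ⟨_, hg⟩, hg'⟩
  choose g hgL hgq using hext
  have hae : ∀ᵐ z ∂μ.restrict K, ∀ i, DifferentiableAt ℝ (g i) z := by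
    apply MeasureTheory.ae_restrict_of_ae
    rw [MeasureTheory.ae_all_iff]
    intro i
    obtain ⟨L, hL'⟩ := hgL i
    exact hL'.ae_differentiableAt
  have hne : μ.restrict K ≠ 0 := by
    rwa [Ne, MeasureTheory.Measure.restrict_eq_zero]
  haveI : (MeasureTheory.ae (μ.restrict K)).NeBot := MeasureTheory.ae_neBot.2 hne
  obtain ⟨z, hzd, hzK, hzden⟩ := (hae.and
    ((MeasureTheory.ae_restrict_mem hKc.measurableSet).and (vs_density μ K))).exists
  have hexp : ∀ i, ∀ ε > 0, ∀ᶠ y in 𝓝 z,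
        |u i y - u i z - ⟪q i z, y - z⟫ - 1 / 2 * ⟪fderiv ℝ (g i) z (y - z), y - z⟫|
          ≤ ε * ‖y - z‖ ^ 2 := by
    intro i
    refine vs_expand (u i) (q i) c hc (hq i) z _ ?_
    intro ε hε
    set A := fderiv ℝ (g i) z
    set D := 6 * c + 2 + ‖A‖ with hD
    have hDpos : 0 < D := by positivity
    obtain ⟨m, hm⟩ := exists_nat_one_div_lt (show 0 < min 1 (ε / D) by positivity)
    set θ : ℝ := 1 / (m + 1 : ℝ) with hθ
    have hθ0 : 0 < θ := by positivity
    have hθ1 : θ ≤ 1 := hm.le.trans (min_le_left _ _)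
    have hθ2 : θ * D ≤ ε := by
      rw [← le_div_iff₀ hDpos]; exact hm.le.trans (min_le_right _ _)
    have h1 := (hzd i).hasFDerivAt.isLittleO.def hθ0
    obtain ⟨ρ, hρ, h1⟩ := Metric.eventually_nhds_iff.1 h1
    have h2 := hzden m
    rw [eventually_nhdsWithin_iff] at h2
    filter_upwards [h2, Metric.ball_mem_nhds z (half_pos hρ)] with x hx hxb
    by_cases hxz : x = z
    · subst hxz; simp
    obtain ⟨x', hx'K, hx'⟩ := hx hxz
    have hn : ‖x' - z‖ ≤ 2 * ‖x - z‖ := by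
      have : x' - z = -(x - x') + (x - z) := by abel
      have h3 := norm_add_le (-(x - x')) (x - z)
      rw [← this, norm_neg] at h3
      have : θ * ‖x - z‖ ≤ 1 * ‖x - z‖ := by gcongr
      linarith
    have h3 : ‖g i x' - g i z - A (x' - z)‖ ≤ θ * ‖x' - z‖ := by
      apply h1
      rw [Metric.mem_ball, dist_eq_norm] at hxb
      rw [dist_eq_norm]; linarith
    rw [← hgq i hx'K, ← hgq i hzK] at h3
    have h4 := hL i x' hx'K x
    have h5 : ‖A (x' - x)‖ ≤ ‖A‖ * ‖x - x'‖ := by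
      rw [← norm_neg (x - x'), neg_sub]; exact A.le_opNorm _
    have e : q i x - q i z - A (x - z)
        = (q i x - q i x') + (q i x' - q i z - A (x' - z)) + A (x' - x) := by
      have : x - z = (x' - z) - (x' - x) := by abel
      rw [this, map_sub]; abel
    rw [e]
    refine (norm_add₃_le).trans ?_
    have h6 : ‖A‖ * ‖x - x'‖ ≤ ‖A‖ * (θ * ‖x - z‖) := by gcongr
    have h7 : 6 * c * ‖x - x'‖ ≤ 6 * c * (θ * ‖x - z‖) := by gcongr
    have h8 : θ * ‖x' - z‖ ≤ θ * (2 * ‖x - z‖) := by gcongr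
    have h9 : θ * D * ‖x - z‖ ≤ ε * ‖x - z‖ := by gcongr
    rw [hD] at h9
    linarith
  refine ⟨z, fun i => fderiv ℝ (g i) z, hzK.1, hzK.2, ?_, hexp⟩
  intro k
  by_contra hpos
  push Not at hpos
  set S := ∑ i, ⟪fderiv ℝ (g i) z k, k⟫ with hS
  -- choose ε with (card) ε ‖k‖² < S/2
  set ε := S / (4 * (Fintype.card ι + 1) * (‖k‖ ^ 2 + 1)) with hε
  have hε0 : 0 < ε := by positivity
  have hall : ∀ᶠ y in 𝓝 z, ∀ i,
        |u i y - u i z - ⟪q i z, y - z⟫ - 1 / 2 * ⟪fderiv ℝ (g i) z (y - z), y - z⟫|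
          ≤ ε * ‖y - z‖ ^ 2 := eventually_all.2 fun i => hexp i ε hε0
  have ht : Tendsto (fun s : ℝ => z + s • k) (𝓝[>] 0) (𝓝 z) := by
    have : Continuous (fun s : ℝ => z + s • k) := by fun_prop
    have := this.tendsto 0
    simp only [zero_smul, add_zero] at this
    exact this.mono_left nhdsWithin_le_nhds
  obtain ⟨s, hs, hs0⟩ := ((ht.eventually hall).and self_mem_nhdsWithin).exists
  have hs0 : 0 < s := hs0
  simp only [add_sub_cancel_left, map_smul, inner_smul_left, inner_smul_right, norm_smul,
    Real.norm_eq_abs, abs_of_pos hs0] at hs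
  have h1 : ∑ i, (u i z + s * ⟪q i z, k⟫ + 1 / 2 * (s * (s * ⟪fderiv ℝ (g i) z k, k⟫))
      - ε * (s * ‖k‖) ^ 2) ≤ ∑ i, u i (z + s • k) := by
    refine Finset.sum_le_sum fun i _ => ?_
    have := (abs_le.1 (hs i)).1
    simp only [conj_trivial] at this
    linarith
  have h2 := hzK.2 (z + s • k)
  rw [add_sub_cancel_left, inner_smul_right, sum_inner] at h2
  rw [Finset.sum_sub_distrib, Finset.sum_add_distrib, Finset.sum_add_distrib, ← Finset.mul_sum,
    ← Finset.mul_sum, ← Finset.mul_sum, ← Finset.mul_sum, ← hS, Finset.sum_const, Finset.card_univ,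
    nsmul_eq_mul] at h1
  have h3 : (Fintype.card ι : ℝ) * (ε * (s * ‖k‖) ^ 2) ≤ s ^ 2 * (S / 4) := by
    have e1 : (Fintype.card ι : ℝ) * (ε * (s * ‖k‖) ^ 2)
        = s ^ 2 * (ε * (Fintype.card ι * ‖k‖ ^ 2)) := by ring
    rw [e1]
    gcongr
    have e2 : S / 4 = ε * ((Fintype.card ι + 1) * (‖k‖ ^ 2 + 1)) := by
      rw [hε]; field_simp
    rw [e2]
    have : (0 : ℝ) ≤ Fintype.card ι := by positivity
    gcongr <;> linarith
  have h4 : 0 < s ^ 2 * (S / 4) := by positivity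
  nlinarith


lemma vs_sums {ι : Type*} [Fintype ι] [Nonempty ι] (Q : Set H) (hQ : IsCompact Q)
    (hne : Q.Nonempty) (f : ι → H → ℝ) (hf : ∀ i, UpperSemicontinuousOn (f i) Q)
    (n : ℝ) (hn : 0 < n) (δ : ℝ) (hδ : 0 < δ) :
    ∃ (z : H) (y : ι → H) (q : ι → H) (A : ι → H →L[ℝ] H), (∀ i, y i ∈ Q) ∧ ‖∑ i, q i‖ ≤ δ ∧
      (∀ k, ∑ i, ⟪A i k, k⟫ ≤ 0) ∧
      (∀ z₀ ∈ Q, ∑ i, f i z₀ ≤ ∑ i, (f i (y i) - n * ‖y i - z‖ ^ 2) + δ * ‖z₀ - z‖) ∧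
      ∀ i, ∀ ε > 0, ∀ᶠ x in 𝓝[Q] (y i), f i x ≤ f i (y i) + ⟪q i, x - y i⟫
        + 1 / 2 * ⟪A i (x - y i), x - y i⟫ + ε * ‖x - y i‖ ^ 2 := by
  have hY : ∀ i z, ∃ y ∈ Q, ∀ x ∈ Q, f i x - n * ‖x - z‖ ^ 2 ≤ f i y - n * ‖y - z‖ ^ 2 := by
    intro i z
    have hus : UpperSemicontinuousOn (fun x => f i x + (- (n * ‖x - z‖ ^ 2))) Q := by
      refine (hf i).add (ContinuousOn.upperSemicontinuousOn ?_)
      have : Continuous (fun x : H => -(n * ‖x - z‖ ^ 2)) := by fun_prop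
      exact this.continuousOn
    obtain ⟨y, hy, hm⟩ := UpperSemicontinuousOn.exists_isMaxOn hne hQ hus
    refine ⟨y, hy, fun x hx => ?_⟩
    have := hm hx
    simp only [mem_ofPred_eq] at this
    linarith
  choose Y hYQ hYm using hY
  set u : ι → H → ℝ := fun i z => f i (Y i z) - n * ‖Y i z - z‖ ^ 2 with hu
  set q : ι → H → H := fun i z => (2 * n) • (Y i z - z) with hqdef
  have hq : ∀ i x y, u i x + ⟪q i x, y - x⟫ - n * ‖y - x‖ ^ 2 ≤ u i y := by
    intro i x y
    have h1 := hYm i y (Y i x) (hYQ i x)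
    have h2 : ‖Y i x - y‖ ^ 2 = ‖Y i x - x‖ ^ 2 - 2 * ⟪Y i x - x, y - x⟫ + ‖y - x‖ ^ 2 := by
      rw [← norm_sub_sq_real]; congr 2; abel
    rw [h2] at h1
    simp only [hu, hqdef, inner_smul_left, conj_trivial]
    linarith
  obtain ⟨R, hR0, hR⟩ : ∃ R > 0, ∀ x ∈ Q, ‖x‖ ≤ R := hQ.isBounded.exists_pos_norm_le
  have hYR : ∀ i z, ‖Y i z‖ ≤ R := fun i z => hR _ (hYQ i z)
  have hqR : ∀ i z, ‖q i z‖ ≤ 2 * n * (R + ‖z‖) := by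
    intro i z
    rw [hqdef, norm_smul, Real.norm_eq_abs, abs_of_pos (by positivity)]
    have := norm_sub_le (Y i z) z
    have := hYR i z
    gcongr; linarith
  have hucont : ∀ i, Continuous (u i) := by
    intro i
    rw [continuous_iff_continuousAt]
    intro x₀
    rw [ContinuousAt, tendsto_iff_norm_sub_tendsto_zero]
    have h0 : Tendsto (fun x => 2 * n * (R + ‖x‖ + ‖x₀‖) * ‖x - x₀‖ + n * ‖x - x₀‖ ^ 2) (𝓝 x₀)
        (𝓝 0) := by
      have : Continuous (fun x => 2 * n * (R + ‖x‖ + ‖x₀‖) * ‖x - x₀‖ + n * ‖x - x₀‖ ^ 2) := by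
        fun_prop
      have := this.tendsto x₀
      simpa using this
    refine squeeze_zero (fun _ => norm_nonneg _) (fun x => ?_) h0
    rw [Real.norm_eq_abs, abs_le]
    have h1 := hq i x x₀
    have h2 := hq i x₀ x
    have h3 := (abs_le.1 (abs_real_inner_le_norm (q i x) (x₀ - x))).1
    have h4 := (abs_le.1 (abs_real_inner_le_norm (q i x₀) (x - x₀))).1
    rw [norm_sub_rev x₀ x] at h1 h3
    have h5 : ‖q i x‖ * ‖x - x₀‖ ≤ 2 * n * (R + ‖x‖ + ‖x₀‖) * ‖x - x₀‖ := by
      gcongr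
      refine (hqR i x).trans ?_
      exact mul_le_mul_of_nonneg_left (by linarith [norm_nonneg x₀]) (by positivity)
    have h6 : ‖q i x₀‖ * ‖x - x₀‖ ≤ 2 * n * (R + ‖x‖ + ‖x₀‖) * ‖x - x₀‖ := by
      gcongr
      refine (hqR i x₀).trans ?_
      exact mul_le_mul_of_nonneg_left (by linarith [norm_nonneg x]) (by positivity)
    constructor <;> linarith
  have hS : ∀ i, ∃ S, ∀ x ∈ Q, f i x ≤ S := by
    intro i
    obtain ⟨y, hy, hm⟩ := UpperSemicontinuousOn.exists_isMaxOn hne hQ (hf i)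
    exact ⟨f i y, fun x hx => hm hx⟩
  choose S hS using hS
  have hmax : ∀ p : H, ‖p‖ ≤ δ → ∃ z, ∀ y, ∑ i, u i y ≤ ∑ i, u i z + ⟪p, y - z⟫ := by
    intro p hp
    have hcont : Continuous (fun y => ∑ i, u i y - ⟪p, y⟫) := by
      refine (continuous_finsetSum _ fun i _ => hucont i).sub (by fun_prop)
    set f0 := ∑ i, u i 0 - ⟪p, (0 : H)⟫ with hf0
    have hev : ∀ᶠ y in cocompact H, ∑ i, u i y - ⟪p, y⟫ ≤ ∑ i, u i 0 - ⟪p, (0 : H)⟫ := by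
      have hno := tendsto_norm_cocompact_atTop (E := H)
      filter_upwards [hno.eventually_ge_atTop (2 * R), hno.eventually_ge_atTop (4 * (δ + 1) / n),
        hno.eventually_ge_atTop |(∑ i, S i) - f0|] with y h1 h2 h3
      have h4 : ∀ i, u i y ≤ S i - n * (‖y‖ ^ 2 / 4) := by
        intro i
        have a1 := hS i _ (hYQ i y)
        have a2 : ‖y‖ / 2 ≤ ‖Y i y - y‖ := by
          have := norm_sub_norm_le y (Y i y)
          rw [norm_sub_rev] at this
          have := hYR i y
          linarith
        have a3 : (‖y‖ / 2) ^ 2 ≤ ‖Y i y - y‖ ^ 2 := by gcongr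
        have a4 : n * (‖y‖ / 2) ^ 2 ≤ n * ‖Y i y - y‖ ^ 2 := by gcongr
        simp only [hu]
        linarith
      have h5 : ∑ i, u i y ≤ ∑ i, (S i - n * (‖y‖ ^ 2 / 4)) := Finset.sum_le_sum fun i _ => h4 i
      have h5a : ∑ i, (S i - n * (‖y‖ ^ 2 / 4))
          = ∑ i, S i - (Fintype.card ι : ℝ) * (n * (‖y‖ ^ 2 / 4)) := by
        rw [Finset.sum_sub_distrib, Finset.sum_const, Finset.card_univ, nsmul_eq_mul]
      rw [h5a] at h5
      have h6 : (1 : ℝ) ≤ Fintype.card ι := by exact_mod_cast Fintype.card_pos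
      have h7 : 0 ≤ n * (‖y‖ ^ 2 / 4) := by positivity
      have h8 := (abs_le.1 (abs_real_inner_le_norm p y)).1
      have h9 : ‖p‖ * ‖y‖ ≤ δ * ‖y‖ := by gcongr
      have h10 := le_abs_self ((∑ i, S i) - f0)
      rw [div_le_iff₀ hn] at h2
      nlinarith [norm_nonneg y]
    obtain ⟨z, hz⟩ := hcont.exists_forall_ge' 0 hev
    refine ⟨z, fun y => ?_⟩
    have := hz y
    rw [inner_sub_right]; linarith
  obtain ⟨z, A, h1, h2, h3, h4⟩ := vs_jensen u q n hn.le hq δ hδ hmax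
  refine ⟨z, fun i => Y i z, fun i => q i z, A, fun i => hYQ i z, h1, h3, ?_, ?_⟩
  · intro z₀ hz₀
    have a1 := h2 z₀
    have a2 : ∑ i, f i z₀ ≤ ∑ i, u i z₀ := by
      refine Finset.sum_le_sum fun i _ => ?_
      have := hYm i z₀ z₀ hz₀
      simpa [hu] using this
    have a3 := (abs_le.1 (abs_real_inner_le_norm (∑ i, q i z) (z₀ - z))).2
    have a4 : ‖∑ i, q i z‖ * ‖z₀ - z‖ ≤ δ * ‖z₀ - z‖ := by gcongr
    linarith
  · intro i ε hε
    have ht : Tendsto (fun x => x + (z - Y i z)) (𝓝[Q] (Y i z)) (𝓝 z) := by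
      have : Continuous (fun x => x + (z - Y i z)) := by fun_prop
      have := this.tendsto (Y i z)
      simp only [add_sub_cancel] at this
      exact this.mono_left nhdsWithin_le_nhds
    filter_upwards [ht.eventually (h4 i ε hε), self_mem_nhdsWithin] with x hx hxQ
    have e : x + (z - Y i z) - z = x - Y i z := by abel
    rw [e] at hx
    have a1 := (abs_le.1 hx).2
    have a2 := hYm i (x + (z - Y i z)) x hxQ
    have e2 : x - (x + (z - Y i z)) = Y i z - z := by abel
    rw [e2] at a2
    simp only [hu] at a1
    linarith

end TheoremOnSums

section PDE
open scoped RealInnerProductSpace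

def vsPhi {N : ℕ} (x : Euc N) : ℝ := ∑ i, Real.cosh (x i)

lemma vs_hasF {N : ℕ} (c b d : ℝ) (p x0 : Euc N) (B : Euc N →L[ℝ] Euc N →L[ℝ] ℝ) (x : Euc N) :
    HasFDerivAt (fun x : Euc N => c * (⟪p, x - x0⟫ + 1 / 2 * B (x - x0) (x - x0)) + b * vsPhi x + d)
      (c • (innerSL ℝ p + (1 / 2 : ℝ) • (B (x - x0) + B.flip (x - x0)))
        + b • ∑ i, Real.sinh (x i) • (EuclideanSpace.proj i : Euc N →L[ℝ] ℝ)) x := by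
  have h0 : HasFDerivAt (fun x : Euc N => x - x0) (ContinuousLinearMap.id ℝ (Euc N)) x :=
    (hasFDerivAt_id x).sub_const x0
  have h1 : HasFDerivAt (fun x : Euc N => ⟪p, x - x0⟫) (innerSL ℝ p) x := by
    have := (innerSL ℝ p).hasFDerivAt.comp x h0
    simpa [Function.comp_def] using this
  have h2 : HasFDerivAt (fun x : Euc N => B (x - x0) (x - x0))
      (B (x - x0) + B.flip (x - x0)) x := by
    have := B.hasFDerivAt_of_bilinear h0 h0
    refine this.congr_fderiv ?_
    ext k; simp
  have h3 : HasFDerivAt (fun x : Euc N => vsPhi x)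
      (∑ i, Real.sinh (x i) • (EuclideanSpace.proj i : Euc N →L[ℝ] ℝ)) x := by
    unfold vsPhi
    refine HasFDerivAt.fun_sum (fun i _ => ?_)
    exact (Real.hasDerivAt_cosh (x i)).comp_hasFDerivAt x
      (EuclideanSpace.proj i : Euc N →L[ℝ] ℝ).hasFDerivAt
  exact (((h1.add (h2.const_mul (1/2))).const_mul c).add (h3.const_mul b)).add_const d

lemma vs_hasF2 {N : ℕ} (c b : ℝ) (p x0 : Euc N) (B : Euc N →L[ℝ] Euc N →L[ℝ] ℝ) (x : Euc N) :
    HasFDerivAt (fun x : Euc N => (c • (innerSL ℝ p + (1 / 2 : ℝ) • (B (x - x0) + B.flip (x - x0)))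
        + b • ∑ i, Real.sinh (x i) • (EuclideanSpace.proj i : Euc N →L[ℝ] ℝ)))
      (c • ((1 / 2 : ℝ) • (B + B.flip))
        + b • ∑ i, (Real.cosh (x i) • (EuclideanSpace.proj i : Euc N →L[ℝ] ℝ)).smulRight
          (EuclideanSpace.proj i : Euc N →L[ℝ] ℝ)) x := by
  have h0 : HasFDerivAt (fun x : Euc N => x - x0) (ContinuousLinearMap.id ℝ (Euc N)) x :=
    (hasFDerivAt_id x).sub_const x0
  have h2 : HasFDerivAt (fun x : Euc N => B (x - x0) + B.flip (x - x0)) (B + B.flip) x := by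
    have h3 := (B.hasFDerivAt (x := x - x0)).comp x h0
    have h4 := (B.flip.hasFDerivAt (x := x - x0)).comp x h0
    exact h3.add h4
  have h3 : HasFDerivAt (fun x : Euc N =>
      ∑ i, Real.sinh (x i) • (EuclideanSpace.proj i : Euc N →L[ℝ] ℝ))
      (∑ i, (Real.cosh (x i) • (EuclideanSpace.proj i : Euc N →L[ℝ] ℝ)).smulRight
          (EuclideanSpace.proj i : Euc N →L[ℝ] ℝ)) x := by
    refine HasFDerivAt.fun_sum (fun i _ => ?_)
    have := (Real.hasDerivAt_sinh (x i)).comp_hasFDerivAt x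
      (EuclideanSpace.proj i : Euc N →L[ℝ] ℝ).hasFDerivAt
    exact this.smul_const (EuclideanSpace.proj i : Euc N →L[ℝ] ℝ)
  exact ((((h2.const_smul (1/2 : ℝ)).const_add (innerSL ℝ p)).const_smul c)).add (h3.const_smul b)

lemma vs_grad {N : ℕ} (c b d : ℝ) (p x0 : Euc N) (B : Euc N →L[ℝ] Euc N →L[ℝ] ℝ) :
    gradient (fun x : Euc N => c * (⟪p, x - x0⟫ + 1 / 2 * B (x - x0) (x - x0)) + b * vsPhi x + d) x0
      = c • p + b • (WithLp.toLp 2 (fun i => Real.sinh (x0 i)) : Euc N) := by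
  apply HasGradientAt.gradient
  rw [hasGradientAt_iff_hasFDerivAt]
  refine (vs_hasF c b d p x0 B x0).congr_fderiv ?_
  ext k
  simp [PiLp.inner_apply, mul_comm]

lemma vs_hess {N : ℕ} (c b d : ℝ) (p x0 : Euc N) (B : Euc N →L[ℝ] Euc N →L[ℝ] ℝ) (k l : Euc N) :
    iteratedFDeriv ℝ 2 (fun x : Euc N => c * (⟪p, x - x0⟫ + 1 / 2 * B (x - x0) (x - x0)) + b * vsPhi x + d) x0
      ![k, l]
      = c * (1 / 2 * (B k l + B l k)) + b * ∑ i, Real.cosh (x0 i) * k i * l i := by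
  rw [iteratedFDeriv_two_apply]
  have : fderiv ℝ (fun x : Euc N => c * (⟪p, x - x0⟫ + 1 / 2 * B (x - x0) (x - x0)) + b * vsPhi x + d)
      = _ := funext fun x => (vs_hasF c b d p x0 B x).fderiv
  rw [this, (vs_hasF2 c b p x0 B x0).fderiv]
  simp only [Matrix.cons_val_zero, Matrix.cons_val_one, add_apply,
    smul_apply, sum_apply, ContinuousLinearMap.flip_apply,
    ContinuousLinearMap.smulRight_apply, smul_eq_mul]
  rfl

abbrev VsH (N : ℕ) := WithLp 2 (ℝ × Euc N)

def vsJ (N : ℕ) : Euc N →L[ℝ] VsH N :=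
  (WithLp.prodContinuousLinearEquiv 2 ℝ ℝ (Euc N)).symm.toContinuousLinearMap ∘L
    ContinuousLinearMap.inr ℝ ℝ (Euc N)

lemma vsJ_apply {N : ℕ} (h : Euc N) : vsJ N h = WithLp.toLp 2 ((0 : ℝ), h) := rfl

def vsB {N : ℕ} (A : VsH N →L[ℝ] VsH N) : Euc N →L[ℝ] Euc N →L[ℝ] ℝ :=
  ContinuousLinearMap.bilinearComp
    ((isBoundedBilinearMap_inner (𝕜 := ℝ) (E := VsH N)).toContinuousLinearMap) (A ∘L vsJ N) (vsJ N)

lemma vsB_apply {N : ℕ} (A : VsH N →L[ℝ] VsH N) (h k : Euc N) :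
    vsB A h k = ⟪A (vsJ N h), vsJ N k⟫ := rfl

/-- symmetrised spatial block of `A` -/
def vsX {N : ℕ} (A : VsH N →L[ℝ] VsH N) : Matrix (Fin N) (Fin N) ℝ := fun i j =>
  1 / 2 * (vsB A (EuclideanSpace.single i 1) (EuclideanSpace.single j 1)
    + vsB A (EuclideanSpace.single j 1) (EuclideanSpace.single i 1))

def vsBeta {N : ℕ} (ε K η Λ th : ℝ) (q : ℝ × Euc N) : ℝ :=
  ε * Real.exp (K * q.1) * vsPhi q.2 + η * Real.exp (Λ * (q.1 - th))

def vsQuad {N : ℕ} (q0 : ℝ × Euc N) (Qv : VsH N) (A : VsH N →L[ℝ] VsH N) (q : ℝ × Euc N) : ℝ :=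
  ⟪Qv, WithLp.toLp 2 q - WithLp.toLp 2 q0⟫
    + 1 / 2 * ⟪A (WithLp.toLp 2 q - WithLp.toLp 2 q0), WithLp.toLp 2 q - WithLp.toLp 2 q0⟫

def vsSh {N : ℕ} (x : Euc N) : Euc N := WithLp.toLp 2 (fun i => Real.sinh (x i))
def vsCh {N : ℕ} (x : Euc N) : Matrix (Fin N) (Fin N) ℝ := Matrix.diagonal (fun i => Real.cosh (x i))

lemma vsPhi_contDiff {N : ℕ} : ContDiff ℝ 2 (fun q : ℝ × Euc N => vsPhi q.2) := by
  unfold vsPhi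
  refine ContDiff.sum (fun i _ => ?_)
  exact Real.contDiff_cosh.comp (by fun_prop)

lemma vsBeta_contDiff {N : ℕ} (ε K η Λ th : ℝ) :
    ContDiff ℝ 2 (vsBeta ε K η Λ th : ℝ × Euc N → ℝ) := by
  have := vsPhi_contDiff (N := N)
  unfold vsBeta
  refine ContDiff.add (ContDiff.mul ?_ this) ?_ <;> fun_prop

lemma vsQuad_contDiff {N : ℕ} (q0 : ℝ × Euc N) (Qv : VsH N) (A : VsH N →L[ℝ] VsH N) :
    ContDiff ℝ 2 (vsQuad q0 Qv A) := by
  have h : ContDiff ℝ 2 (fun q : ℝ × Euc N => (WithLp.toLp 2 q : VsH N) - WithLp.toLp 2 q0) :=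
    (WithLp.prodContinuousLinearEquiv 2 ℝ ℝ (Euc N)).symm.contDiff.sub contDiff_const
  unfold vsQuad
  exact (contDiff_const.inner ℝ h).add (contDiff_const.mul ((A.contDiff.comp h).inner ℝ h))

section
variable {N : ℕ} (c a ε K η Λ th : ℝ) (q0 : ℝ × Euc N) (Qv : VsH N) (A : VsH N →L[ℝ] VsH N)

lemma vs_slice : (fun z : Euc N => c * vsQuad q0 Qv A (q0.1, z) + a * vsBeta ε K η Λ th (q0.1, z))
   = fun x : Euc N => c * (⟪Qv.snd, x - q0.2⟫ + 1 / 2 * vsB A (x - q0.2) (x - q0.2))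
     + (a * (ε * Real.exp (K * q0.1))) * vsPhi x + a * (η * Real.exp (Λ * (q0.1 - th))) := by
  funext x
  have h : (WithLp.toLp 2 (q0.1, x) : VsH N) - WithLp.toLp 2 q0 = vsJ N (x - q0.2) := by
    rw [vsJ_apply, ← WithLp.toLp_sub]
    congr 1
    ext <;> simp
  simp only [vsQuad, vsBeta, h, vsB_apply]
  have h2 : ⟪Qv, vsJ N (x - q0.2)⟫ = ⟪Qv.snd, x - q0.2⟫ := by
    rw [vsJ_apply, WithLp.prod_inner_apply]; simp
  rw [h2]; ring

lemma vs_xgrad : xgrad (fun q => c * vsQuad q0 Qv A q + a * vsBeta ε K η Λ th q) q0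
    = c • Qv.snd + (a * (ε * Real.exp (K * q0.1))) • vsSh q0.2 := by
  unfold xgrad
  rw [vs_slice, vs_grad]; rfl

lemma vs_xhess : xhess (fun q => c * vsQuad q0 Qv A q + a * vsBeta ε K η Λ th q) q0
    = c • vsX A + (a * (ε * Real.exp (K * q0.1))) • vsCh q0.2 := by
  unfold xhess
  ext i j
  rw [vs_slice, vs_hess]
  simp only [vsX, vsCh, Matrix.add_apply, Matrix.smul_apply, smul_eq_mul, Matrix.diagonal_apply]
  congr 2
  simp only [PiLp.single_apply, mul_ite, mul_one, mul_zero, ite_mul, zero_mul, Finset.sum_ite_eq,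
    Finset.sum_ite_eq', Finset.mem_univ, if_true]
  by_cases h : i = j <;> simp [h, eq_comm]

lemma vs_tderiv : tderiv (fun q => c * vsQuad q0 Qv A q + a * vsBeta ε K η Λ th q) q0
    = c * Qv.fst + a * (K * (ε * Real.exp (K * q0.1)) * vsPhi q0.2
      + Λ * (η * Real.exp (Λ * (q0.1 - th)))) := by
  unfold tderiv
  have h : ∀ s, (WithLp.toLp 2 (s, q0.2) : VsH N) - WithLp.toLp 2 q0
      = (s - q0.1) • WithLp.toLp 2 ((1 : ℝ), (0 : Euc N)) := by
    intro s
    rw [← WithLp.toLp_sub, ← WithLp.toLp_smul]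
    congr 1
    ext <;> simp
  set e : VsH N := WithLp.toLp 2 ((1 : ℝ), (0 : Euc N)) with he
  have h2 : ⟪Qv, e⟫ = Qv.fst := by
    rw [he, WithLp.prod_inner_apply]; simp
  have h3 : (fun s : ℝ => c * vsQuad q0 Qv A (s, q0.2) + a * vsBeta ε K η Λ th (s, q0.2))
    = fun s => c * ((s - q0.1) * Qv.fst + 1 / 2 * ((s - q0.1) ^ 2 * ⟪A e, e⟫))
      + a * (ε * Real.exp (K * s) * vsPhi q0.2 + η * Real.exp (Λ * (s - th))) := by
    funext s
    simp only [vsQuad, vsBeta, h, map_smul, inner_smul_left, inner_smul_right, h2]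
    simp only [conj_trivial]; ring
  rw [h3]
  apply HasDerivAt.deriv
  have d0 : HasDerivAt (fun s : ℝ => s - q0.1) 1 q0.1 := (hasDerivAt_id _).sub_const _
  have d1 : HasDerivAt (fun s : ℝ => Real.exp (K * s)) (Real.exp (K * q0.1) * (K * 1)) q0.1 :=
    ((hasDerivAt_id _).const_mul K).exp
  have d2 : HasDerivAt (fun s : ℝ => Real.exp (Λ * (s - th)))
      (Real.exp (Λ * (q0.1 - th)) * (Λ * 1)) q0.1 :=
    (((hasDerivAt_id _).sub_const th).const_mul Λ).exp
  have := (((d0.mul_const Qv.fst).add (((d0.pow 2).mul_const ⟪A e, e⟫).const_mul (1/2))).const_mul c).add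
    ((((d1.const_mul ε).mul_const (vsPhi q0.2)).add (d2.const_mul η)).const_mul a)
  refine this.congr_deriv ?_
  rw [sub_self]; norm_num; ring_nf; simp
end

end PDE

section PDE2
open scoped RealInnerProductSpace
lemma vsX_symm {N : ℕ} (A : VsH N →L[ℝ] VsH N) : (vsX A).IsSymm := by
  ext i j; simp [vsX, Matrix.transpose_apply, add_comm]

lemma vsCh_symm {N : ℕ} (x : Euc N) : (vsCh x).IsSymm := by
  simp [vsCh, Matrix.IsSymm]

lemma vsX_add {N : ℕ} (A : VsH N →L[ℝ] VsH N) (e : ℝ) :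
    vsX (A + e • ContinuousLinearMap.id ℝ (VsH N)) = vsX A + e • (1 : Matrix (Fin N) (Fin N) ℝ) := by
  ext i j
  simp only [vsX, vsB_apply, Matrix.add_apply, Matrix.smul_apply, smul_eq_mul, add_apply, smul_apply,
    ContinuousLinearMap.id_apply, inner_add_left, inner_smul_left, conj_trivial]
  have : ∀ i j : Fin N, ⟪vsJ N (EuclideanSpace.single i (1:ℝ)), vsJ N (EuclideanSpace.single j (1:ℝ))⟫
      = (1 : Matrix (Fin N) (Fin N) ℝ) i j := by
    intro i j
    rw [vsJ_apply, vsJ_apply, WithLp.prod_inner_apply]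
    simp [Matrix.one_apply, EuclideanSpace.inner_single_left, Pi.single_apply]
  rw [this, this, ← Matrix.transpose_apply 1 i j, Matrix.transpose_one]; ring

lemma vsX_quad {N : ℕ} (A : VsH N →L[ℝ] VsH N) (w : Fin N → ℝ) :
    w ⬝ᵥ (vsX A).mulVec w = ⟪A (vsJ N (WithLp.toLp 2 w)), vsJ N (WithLp.toLp 2 w)⟫ := by
  rw [← vsB_apply]
  have hw : (WithLp.toLp 2 w : Euc N) = ∑ i, w i • EuclideanSpace.single i (1:ℝ) := by
    ext j; simp [Pi.single_apply]
  rw [hw]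
  simp only [map_sum, map_smul, sum_apply, smul_apply, smul_eq_mul, dotProduct, Matrix.mulVec, vsX, Finset.mul_sum]
  have h : ∀ i j, w i * (1 / 2 * (vsB A (EuclideanSpace.single i 1) (EuclideanSpace.single j 1)
    + vsB A (EuclideanSpace.single j 1) (EuclideanSpace.single i 1)) * w j)
    = 1 / 2 * (w i * (w j * vsB A (EuclideanSpace.single i 1) (EuclideanSpace.single j 1)))
     + 1 / 2 * (w i * (w j * vsB A (EuclideanSpace.single j 1) (EuclideanSpace.single i 1))) := by
    intro i j; ring
  simp only [h, Finset.sum_add_distrib]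
  rw [Finset.sum_comm]
  rw [← Finset.sum_add_distrib]
  refine Finset.sum_congr rfl fun j _ => ?_
  rw [← Finset.sum_add_distrib]
  refine Finset.sum_congr rfl fun i _ => ?_
  ring

lemma vsX_posSemidef {N : ℕ} (A : Fin 3 → VsH N →L[ℝ] VsH N) (hA : ∀ k, ∑ i, ⟪A i k, k⟫ ≤ 0) :
    (-(vsX (A 0) + vsX (A 1) + vsX (A 2))).PosSemidef := by
  rw [Matrix.posSemidef_iff_dotProduct_mulVec]
  refine ⟨?_, fun w => ?_⟩
  · have := ((vsX_symm (A 0)).add (vsX_symm (A 1))).add (vsX_symm (A 2))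
    rw [Matrix.IsHermitian, Matrix.conjTranspose_eq_transpose_of_trivial, Matrix.transpose_neg, this]
  · rw [star_trivial, Matrix.neg_mulVec, Matrix.add_mulVec, Matrix.add_mulVec, dotProduct_neg,
      dotProduct_add, dotProduct_add, vsX_quad, vsX_quad, vsX_quad]
    have := hA (vsJ N (WithLp.toLp 2 w))
    rw [Fin.sum_univ_three] at this
    linarith

lemma vsPhi_le {N : ℕ} (x : Euc N) (i : Fin N) : Real.cosh (x i) ≤ vsPhi x :=
  Finset.single_le_sum (f := fun i => Real.cosh (x i)) (fun _ _ => (Real.cosh_pos _).le) (Finset.mem_univ i)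

lemma vsPhi_nonneg {N : ℕ} (x : Euc N) : 0 ≤ vsPhi x :=
  Finset.sum_nonneg (fun _ _ => (Real.cosh_pos _).le)

lemma vsSh_norm {N : ℕ} (x : Euc N) : ‖vsSh x‖ ≤ vsPhi x := by
  have hw : vsSh x = ∑ i, Real.sinh (x i) • EuclideanSpace.single i (1:ℝ) := by
    ext j; simp [vsSh, Pi.single_apply]
  rw [hw]
  refine (norm_sum_le _ _).trans (Finset.sum_le_sum fun i _ => ?_)
  rw [norm_smul]
  simp only [PiLp.norm_single, norm_one, mul_one, Real.norm_eq_abs]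
  rw [Real.abs_sinh]
  exact (Real.sinh_lt_cosh _).le.trans (Real.cosh_abs _).le

lemma vsCh_norm {N : ℕ} (x : Euc N) : matOpNorm (vsCh x) ≤ vsPhi x := by
  unfold matOpNorm
  refine ContinuousLinearMap.opNorm_le_bound _ (vsPhi_nonneg x) fun y => ?_
  refine le_of_sq_le_sq ?_ (mul_nonneg (vsPhi_nonneg x) (norm_nonneg y))
  rw [mul_pow, EuclideanSpace.norm_sq_eq, EuclideanSpace.norm_sq_eq, Finset.mul_sum]
  refine Finset.sum_le_sum fun i _ => ?_
  rw [Matrix.ofLp_toEuclideanCLM, vsCh, Matrix.mulVec_diagonal, norm_mul, mul_pow]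
  gcongr
  rw [Real.norm_eq_abs, abs_of_pos (Real.cosh_pos _)]
  exact vsPhi_le x i

lemma vs_matNorm {N : ℕ} (x : Euc N) (a b : ℝ) (ha : 0 ≤ a) (hb : 0 ≤ b) :
    matOpNorm (a • (1 : Matrix (Fin N) (Fin N) ℝ) + b • vsCh x) ≤ a + b * vsPhi x := by
  have h1 := vsCh_norm x
  unfold matOpNorm at *
  rw [map_add, map_smul, map_smul, map_one]
  refine (norm_add_le _ _).trans ?_
  rw [norm_smul, norm_smul, Real.norm_eq_abs, Real.norm_eq_abs, abs_of_nonneg ha, abs_of_nonneg hb]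
  have : ‖(1 : Euc N →L[ℝ] Euc N)‖ ≤ 1 := ContinuousLinearMap.norm_id_le
  nlinarith [mul_le_mul_of_nonneg_left h1 hb]
end PDE2

section PDE3
open scoped RealInnerProductSpace

lemma vs_touch {N : ℕ} (f : VsH N → ℝ) (Q : Set (VsH N)) (y Qv : VsH N) (A : VsH N →L[ℝ] VsH N)
    (hQ : Q ∈ 𝓝 y)
    (h : ∀ ε > 0, ∀ᶠ x in 𝓝[Q] y, f x ≤ f y + ⟪Qv, x - y⟫
        + 1 / 2 * ⟪A (x - y), x - y⟫ + ε * ‖x - y‖ ^ 2) (e : ℝ) (he : 0 < e) :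
    ∀ᶠ q in 𝓝 (WithLp.ofLp y), f (WithLp.toLp 2 q) ≤ f y +
      vsQuad (WithLp.ofLp y) Qv (A + e • ContinuousLinearMap.id ℝ (VsH N)) q := by
  have h1 := h (e / 2) (by positivity)
  rw [nhdsWithin_eq_nhds.2 hQ] at h1
  have hc : Tendsto (fun q : ℝ × Euc N => (WithLp.toLp 2 q : VsH N)) (𝓝 (WithLp.ofLp y)) (𝓝 y) := by
    have : Continuous (fun q : ℝ × Euc N => (WithLp.toLp 2 q : VsH N)) := by fun_prop
    exact this.tendsto' _ _ rfl
  filter_upwards [hc.eventually h1] with q hq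
  refine hq.trans (le_of_eq ?_)
  simp only [vsQuad, WithLp.toLp_ofLp, add_apply, smul_apply, ContinuousLinearMap.id_apply,
    inner_add_left, inner_smul_left, conj_trivial, real_inner_self_eq_norm_sq]
  ring

lemma vs_quad_self {N : ℕ} (q0 : ℝ × Euc N) (Qv : VsH N) (A : VsH N →L[ℝ] VsH N) :
    vsQuad q0 Qv A q0 = 0 := by simp [vsQuad]

lemma vs_sub {N : ℕ} (T : ℝ) (F : Euc N → Matrix (Fin N) (Fin N) ℝ → ℝ) (u : ℝ × Euc N → ℝ)
    (hu : IsViscSubsol' T F u) (c : ℝ) (hc : 0 < c) (Q : Set (VsH N)) (y Qv : VsH N)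
    (A : VsH N →L[ℝ] VsH N) (hQ : Q ∈ 𝓝 y) (hy : y.fst ∈ Ioo 0 T)
    (h : ∀ ε > 0, ∀ᶠ x in 𝓝[Q] y, c * u (WithLp.ofLp x) ≤ c * u (WithLp.ofLp y) + ⟪Qv, x - y⟫
        + 1 / 2 * ⟪A (x - y), x - y⟫ + ε * ‖x - y‖ ^ 2) (e : ℝ) (he : 0 < e) :
    Qv.fst ≤ c * F (c⁻¹ • Qv.snd) (c⁻¹ • (vsX A + e • (1 : Matrix (Fin N) (Fin N) ℝ))) := by
  have h1 := vs_touch (fun x => c * u (WithLp.ofLp x)) Q y Qv A hQ h e he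
  set A' := A + e • ContinuousLinearMap.id ℝ (VsH N) with hA'
  set q0 := WithLp.ofLp y with hq0
  have h2 := hu (fun q => c⁻¹ * vsQuad q0 Qv A' q + 0 * vsBeta 0 0 0 0 0 q)
    ((contDiff_const.mul (vsQuad_contDiff _ _ _)).add (contDiff_const.mul (vsBeta_contDiff _ _ _ _ _)))
    q0 hy (by
      apply Filter.Eventually.filter_mono nhdsWithin_le_nhds
      filter_upwards [h1] with q hq
      simp only [vs_quad_self, zero_mul, add_zero, mul_zero, sub_zero]
      have : u q - c⁻¹ * vsQuad q0 Qv A' q = c⁻¹ * (c * u q - vsQuad q0 Qv A' q) := by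
        field_simp
      rw [this]
      have h3 : u q0 = c⁻¹ * (c * u q0) := by field_simp
      rw [h3]
      gcongr
      linarith)
  rw [vs_tderiv, vs_xgrad, vs_xhess] at h2
  simp only [zero_mul, add_zero, zero_smul, mul_zero] at h2
  rw [vsX_add] at h2
  have h3 : c⁻¹ * Qv.fst ≤ F (c⁻¹ • Qv.snd) (c⁻¹ • (vsX A + e • (1 : Matrix (Fin N) (Fin N) ℝ))) := by
    linarith
  calc Qv.fst = c * (c⁻¹ * Qv.fst) := by field_simp
    _ ≤ _ := by gcongr

lemma vs_super {N : ℕ} (T : ℝ) (F : Euc N → Matrix (Fin N) (Fin N) ℝ → ℝ) (v : ℝ × Euc N → ℝ)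
    (hv : IsViscSupersol' T F v) (κ K η Λ th : ℝ) (Q : Set (VsH N)) (y Qv : VsH N)
    (A : VsH N →L[ℝ] VsH N) (hQ : Q ∈ 𝓝 y) (hy : y.fst ∈ Ioo 0 T)
    (h : ∀ ε > 0, ∀ᶠ x in 𝓝[Q] y, - v (WithLp.ofLp x) - vsBeta κ K η Λ th (WithLp.ofLp x)
        ≤ - v (WithLp.ofLp y) - vsBeta κ K η Λ th (WithLp.ofLp y) + ⟪Qv, x - y⟫
        + 1 / 2 * ⟪A (x - y), x - y⟫ + ε * ‖x - y‖ ^ 2) (e : ℝ) (he : 0 < e) :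
    F (-Qv.snd - (κ * Real.exp (K * y.fst)) • vsSh y.snd)
      (-(vsX A + e • (1 : Matrix (Fin N) (Fin N) ℝ)) - (κ * Real.exp (K * y.fst)) • vsCh y.snd)
      ≤ - Qv.fst - (K * (κ * Real.exp (K * y.fst)) * vsPhi y.snd
      + Λ * (η * Real.exp (Λ * (y.fst - th)))) := by
  have h1 := vs_touch (fun x => - v (WithLp.ofLp x) - vsBeta κ K η Λ th (WithLp.ofLp x)) Q y Qv A hQ h e he
  set A' := A + e • ContinuousLinearMap.id ℝ (VsH N) with hA'
  have h2 := hv (fun q => (-1) * vsQuad (WithLp.ofLp y) Qv A' q + (-1) * vsBeta κ K η Λ th q)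
    ((contDiff_const.mul (vsQuad_contDiff _ _ _)).add (contDiff_const.mul (vsBeta_contDiff _ _ _ _ _)))
    (WithLp.ofLp y) hy (by
      apply Filter.Eventually.filter_mono nhdsWithin_le_nhds
      filter_upwards [h1] with q hq
      simp only [vs_quad_self]
      linarith)
  rw [vs_tderiv, vs_xgrad, vs_xhess, vsX_add] at h2
  have e1 : -Qv.snd - (κ * Real.exp (K * y.fst)) • vsSh y.snd
    = (-1 : ℝ) • Qv.snd + ((-1) * (κ * Real.exp (K * y.fst))) • vsSh y.snd := by module
  have e2 : -(vsX A + e • (1 : Matrix (Fin N) (Fin N) ℝ)) - (κ * Real.exp (K * y.fst)) • vsCh y.snd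
    = (-1 : ℝ) • (vsX A + e • (1 : Matrix (Fin N) (Fin N) ℝ))
      + ((-1) * (κ * Real.exp (K * y.fst))) • vsCh y.snd := by module
  rw [e1, e2]
  simp only [WithLp.ofLp_fst, WithLp.ofLp_snd] at h2
  linarith

end PDE3

section PDE4
open scoped RealInnerProductSpace

lemma vs_ineq {N : ℕ} (F : Euc N → Matrix (Fin N) (Fin N) ℝ → ℝ)
    (C : ℝ) (hC : 0 < C)
    (hlip : ∀ p q : Euc N, ∀ A B : Matrix (Fin N) (Fin N) ℝ, A.IsSymm → B.IsSymm →
      |F p A - F q B| ≤ C * (‖p - q‖ + matOpNorm (A - B)))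
    (hmono : ∀ p : Euc N, ∀ A B : Matrix (Fin N) (Fin N) ℝ, A.IsSymm → B.IsSymm →
      (A - B).PosSemidef → F p B ≤ F p A)
    (α : ℝ) (hα : α ∈ Set.Ioo (0 : ℝ) 1)
    (hconc : ∀ p q : Euc N, ∀ A B : Matrix (Fin N) (Fin N) ℝ, A.IsSymm → B.IsSymm →
      α * F p A + (1 - α) * F q B ≤ F (α • p + (1 - α) • q) (α • A + (1 - α) • B))
    (q : Fin 3 → VsH N) (A : Fin 3 → VsH N →L[ℝ] VsH N) (δ : ℝ) (hq : ‖∑ i, q i‖ ≤ δ)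
    (hA : ∀ k, ∑ i, ⟪A i k, k⟫ ≤ 0) (e : ℝ) (he : 0 < e) (b G : ℝ) (hb : 0 ≤ b) (x : Euc N)
    (h0 : (q 0).fst ≤ α * F (α⁻¹ • (q 0).snd) (α⁻¹ • (vsX (A 0) + e • (1 : Matrix (Fin N) (Fin N) ℝ))))
    (h1 : (q 1).fst ≤ (1 - α) * F ((1 - α)⁻¹ • (q 1).snd)
      ((1 - α)⁻¹ • (vsX (A 1) + e • (1 : Matrix (Fin N) (Fin N) ℝ))))
    (h2 : F (-(q 2).snd - b • vsSh x)
      (-(vsX (A 2) + e • (1 : Matrix (Fin N) (Fin N) ℝ)) - b • vsCh x)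
      ≤ - (q 2).fst - (2 * C * b * vsPhi x + G)) : G ≤ (1 + C) * δ + 3 * C * e := by
  obtain ⟨ha0, ha1⟩ := hα
  have ha2 : (1 - α) ≠ 0 := by linarith
  have ha3 : α ≠ 0 := ha0.ne'
  have s1 : (e • (1 : Matrix (Fin N) (Fin N) ℝ)).IsSymm := Matrix.isSymm_one.smul e
  have sX := fun i => vsX_symm (A i)
  have k1 := hconc (α⁻¹ • (q 0).snd) ((1 - α)⁻¹ • (q 1).snd)
    (α⁻¹ • (vsX (A 0) + e • (1 : Matrix (Fin N) (Fin N) ℝ)))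
    ((1 - α)⁻¹ • (vsX (A 1) + e • (1 : Matrix (Fin N) (Fin N) ℝ)))
    (((sX 0).add s1).smul _) (((sX 1).add s1).smul _)
  rw [smul_inv_smul₀ ha3, smul_inv_smul₀ ha2, smul_inv_smul₀ ha3, smul_inv_smul₀ ha2] at k1
  have k2 := hmono ((q 0).snd + (q 1).snd)
    (-(vsX (A 2)) + (2 * e) • (1 : Matrix (Fin N) (Fin N) ℝ))
    (vsX (A 0) + e • (1 : Matrix (Fin N) (Fin N) ℝ) + (vsX (A 1) + e • (1 : Matrix (Fin N) (Fin N) ℝ)))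
    ((sX 2).neg.add (Matrix.isSymm_one.smul _)) (((sX 0).add s1).add ((sX 1).add s1)) (by
      have := vsX_posSemidef A hA
      convert this using 1
      module)
  have k3 := (abs_le.1 (hlip ((q 0).snd + (q 1).snd) (-(q 2).snd - b • vsSh x)
    (-(vsX (A 2)) + (2 * e) • (1 : Matrix (Fin N) (Fin N) ℝ))
    (-(vsX (A 2) + e • (1 : Matrix (Fin N) (Fin N) ℝ)) - b • vsCh x)
    ((sX 2).neg.add (Matrix.isSymm_one.smul _)) (((sX 2).add s1).neg.sub ((vsCh_symm x).smul _)))).2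
  have e1 : (q 0).snd + (q 1).snd - (-(q 2).snd - b • vsSh x)
      = (∑ i, q i).snd + b • vsSh x := by
    rw [Fin.sum_univ_three]
    simp only [WithLp.add_snd]
    abel
  have e2 : (-(vsX (A 2)) + (2 * e) • (1 : Matrix (Fin N) (Fin N) ℝ)) -
    (-(vsX (A 2) + e • (1 : Matrix (Fin N) (Fin N) ℝ)) - b • vsCh x)
    = (3 * e) • (1 : Matrix (Fin N) (Fin N) ℝ) + b • vsCh x := by module
  rw [e1, e2] at k3
  have n1 := vs_matNorm x (3 * e) b (by positivity) hb
  have n0 : ‖(∑ i, q i).snd‖ ≤ δ := (WithLp.norm_snd_le _ _).trans hq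
  have nf : |(∑ i, q i).fst| ≤ δ := (WithLp.norm_fst_le _ _).trans hq
  have n2 : ‖(∑ i, q i).snd + b • vsSh x‖ ≤ δ + b * vsPhi x := by
    refine (norm_add_le _ _).trans (add_le_add n0 ?_)
    rw [norm_smul, Real.norm_eq_abs, abs_of_nonneg hb]
    exact mul_le_mul_of_nonneg_left (vsSh_norm x) hb
  have e3 : (∑ i, q i).fst = (q 0).fst + (q 1).fst + (q 2).fst := by
    rw [Fin.sum_univ_three]; rfl
  rw [e3] at nf
  have nf' := (abs_le.1 nf).1
  have k4 := mul_le_mul_of_nonneg_left (add_le_add n2 n1) hC.le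
  nlinarith [k1, k2, k3, k4]
end PDE4

section PDE5
open scoped RealInnerProductSpace

lemma vs_growth1 {N : ℕ} (T : ℝ) (u : ℝ × Euc N → ℝ) (hu : PolyGrowth T u) :
    ∃ g : ℝ → ℝ, MonotoneOn g (Ici 0) ∧ (∀ b > 0, g =o[atTop] fun r => Real.exp (b * r)) ∧
      ∀ t ∈ Icc (0 : ℝ) T, ∀ x : Euc N, |u (t, x)| ≤ g ‖x‖ := by
  obtain ⟨C, k, h⟩ := hu
  refine ⟨fun r => |C| * (1 + r ^ k), ?_, ?_, ?_⟩
  · intro a ha b hb hab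
    have : (0 : ℝ) ≤ a := ha
    simp only
    gcongr
  · intro b hb
    refine Asymptotics.IsLittleO.const_mul_left ?_ _
    have h0 := isLittleO_pow_exp_pos_mul_atTop (k := 0) hb
    have h1 := isLittleO_pow_exp_pos_mul_atTop (k := k) hb
    simpa using h0.add h1
  · intro t ht x
    refine (h t ht x).trans ?_
    exact mul_le_mul_of_nonneg_right (le_abs_self C) (by positivity)

lemma vs_phi_lower {N : ℕ} (x : Euc N) (hx : 0 < ‖x‖) :
    Real.exp (1 / (N + 1) * ‖x‖) / 2 ≤ vsPhi x := by
  have hN : (0 : ℝ) < N + 1 := by positivity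
  have : ∃ i, 1 / (N + 1) * ‖x‖ ≤ |x i| := by
    by_contra hcon
    push Not at hcon
    have hw : x = ∑ i, x i • EuclideanSpace.single i (1:ℝ) := by
      ext j; simp [Pi.single_apply]
    have h1 : ‖x‖ ≤ ∑ i : Fin N, 1 / ((N : ℝ) + 1) * ‖x‖ := by
      conv_lhs => rw [hw]
      refine (norm_sum_le _ _).trans (Finset.sum_le_sum fun i _ => ?_)
      rw [norm_smul]
      simp only [PiLp.norm_single, norm_one, mul_one, Real.norm_eq_abs]
      exact (hcon i).le
    rw [Finset.sum_const, Finset.card_univ, Fintype.card_fin, nsmul_eq_mul] at h1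
    have h2 : (N : ℝ) * (1 / (N + 1) * ‖x‖) = ‖x‖ - ‖x‖ / (N + 1) := by field_simp; ring
    have h3 : 0 < ‖x‖ / (N + 1) := by positivity
    linarith
  obtain ⟨i, hi⟩ := this
  refine le_trans ?_ (vsPhi_le x i)
  rw [← Real.cosh_abs, Real.cosh_eq]
  have h1 := Real.exp_le_exp.2 hi
  have h2 := Real.exp_pos (-|x i|)
  linarith

lemma vs_growth2 {N : ℕ} (g : ℝ → ℝ) (hg : ∀ b > 0, g =o[atTop] fun r => Real.exp (b * r))
    (ε : ℝ) (hε : 0 < ε) : ∃ R0 : ℝ, 0 < R0 ∧ ∀ x : Euc N, R0 ≤ ‖x‖ → g ‖x‖ < ε * vsPhi x := by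
  have h := (hg (1 / ((N : ℝ) + 1)) (by positivity)).def (c := ε / 4) (by positivity)
  obtain ⟨R, hR⟩ := eventually_atTop.1 h
  refine ⟨max R 1, by positivity, fun x hx => ?_⟩
  have h1 := hR ‖x‖ ((le_max_left _ _).trans hx)
  have h2 := vs_phi_lower x (lt_of_lt_of_le (by positivity) hx)
  rw [Real.norm_eq_abs, Real.norm_eq_abs, abs_of_pos (Real.exp_pos _)] at h1
  have h3 := le_abs_self (g ‖x‖)
  have h4 := mul_le_mul_of_nonneg_left h2 hε.le
  have h5 := mul_pos hε (Real.exp_pos (1 / ((N : ℝ) + 1) * ‖x‖))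
  linarith

lemma vs_compact {H : Type*} [NormedAddCommGroup H] [InnerProductSpace ℝ H] [FiniteDimensional ℝ H]
    {ι : Type*} [Fintype ι] [Nonempty ι] (Q : Set H) (hQ : IsCompact Q)
    (f : ι → H → ℝ) (hf : ∀ i, UpperSemicontinuousOn (f i) Q) (z0 : H) (hz0 : z0 ∈ Q)
    (hpos : 0 < ∑ i, f i z0) (U : Set H) (hU : IsOpen U)
    (hQU : ∀ z ∈ Q, 0 < ∑ i, f i z → z ∈ U) (δ0 : ℝ) (hδ0 : 0 < δ0) :
    ∃ (y : ι → H) (q : ι → H) (A : ι → H →L[ℝ] H), (∀ i, y i ∈ Q ∧ y i ∈ U) ∧ ‖∑ i, q i‖ ≤ δ0 ∧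
      (∀ k, ∑ i, ⟪A i k, k⟫ ≤ 0) ∧
      ∀ i, ∀ ε > 0, ∀ᶠ x in 𝓝[Q] (y i), f i x ≤ f i (y i) + ⟪q i, x - y i⟫
        + 1 / 2 * ⟪A i (x - y i), x - y i⟫ + ε * ‖x - y i‖ ^ 2 := by
  have key := fun n : ℕ => vs_sums Q hQ ⟨z0, hz0⟩ f hf ((n : ℝ) + 2) (by positivity)
    (1 / ((n : ℝ) + 1)) (by positivity)
  choose z y q A hyQ hq hA hz htouch using key
  let i0 : ι := Classical.arbitrary ι
  -- bounds
  have hbd : ∀ i, ∃ M, ∀ x ∈ Q, f i x ≤ M := fun i => by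
    obtain ⟨M, hM⟩ := (hf i).bddAbove_of_isCompact hQ
    exact ⟨M, fun x hx => hM ⟨x, hx, rfl⟩⟩
  choose M hM using hbd
  obtain ⟨D, hD⟩ := hQ.isBounded.subset_closedBall z0
  have hD' : ∀ x ∈ Q, ‖z0 - x‖ ≤ D := fun x hx => by
    have := hD hx
    rwa [mem_closedBall_iff_norm'] at this
  set L : ℝ := ∑ i, M i + D + 1 with hL
  have hsum : ∀ n, ∑ i, ‖y n i - z n‖ ^ 2 ≤ L / (n + 1) := by
    intro n
    have h1 := hz n z0 hz0
    have hn1 : (0 : ℝ) < n + 1 := by positivity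
    have h2 : ‖z0 - z n‖ ≤ D + 1 + ∑ i, ‖y n i - z n‖ ^ 2 := by
      have a1 : ‖z0 - z n‖ ≤ ‖z0 - y n i0‖ + ‖y n i0 - z n‖ := norm_sub_le_norm_sub_add_norm_sub _ _ _
      have a2 := hD' _ (hyQ n i0)
      have a3 : ‖y n i0 - z n‖ ^ 2 ≤ ∑ i, ‖y n i - z n‖ ^ 2 :=
        Finset.single_le_sum (f := fun i => ‖y n i - z n‖ ^ 2) (fun _ _ => by positivity)
          (Finset.mem_univ i0)
      nlinarith [sq_nonneg (‖y n i0 - z n‖ - 1)]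
    rw [Finset.sum_sub_distrib, ← Finset.mul_sum] at h1
    have h3 : ∑ i, f i (y n i) ≤ ∑ i, M i := Finset.sum_le_sum fun i _ => hM i _ (hyQ n i)
    have h4 : 1 / ((n : ℝ) + 1) * ‖z0 - z n‖ ≤ ‖z0 - z n‖ := by
      refine mul_le_of_le_one_left (norm_nonneg _) ?_
      rw [div_le_one hn1]
      have : (0 : ℝ) ≤ n := by positivity
      linarith
    rw [le_div_iff₀ hn1]
    nlinarith
  have hconv : ∀ i, Tendsto (fun n => y n i - z n) atTop (𝓝 0) := by
    intro i
    have h0 : Tendsto (fun n : ℕ => L / ((n : ℝ) + 1)) atTop (𝓝 0) := by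
      have := (tendsto_one_div_add_atTop_nhds_zero_nat (𝕜 := ℝ)).const_mul L
      simpa [mul_div_assoc, div_eq_mul_inv] using this
    have h1 : Tendsto (fun n => ‖y n i - z n‖ ^ 2) atTop (𝓝 0) := by
      refine squeeze_zero (fun _ => by positivity) (fun n => ?_) h0
      exact (Finset.single_le_sum (f := fun i => ‖y n i - z n‖ ^ 2) (fun _ _ => by positivity)
          (Finset.mem_univ i)).trans (hsum n)
    rw [tendsto_zero_iff_norm_tendsto_zero]
    have h2 := (Real.continuous_sqrt.tendsto 0).comp h1
    simpa [Function.comp_def, Real.sqrt_sq] using h2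
  obtain ⟨zs, hzs, φ, hφ, hlim⟩ := hQ.tendsto_subseq (fun n => hyQ n i0)
  have hzlim : Tendsto (fun n => z (φ n)) atTop (𝓝 zs) := by
    have := hlim.sub ((hconv i0).comp hφ.tendsto_atTop)
    simpa [Function.comp_def] using this
  have hylim : ∀ i, Tendsto (fun n => y (φ n) i) atTop (𝓝 zs) := fun i => by
    have := hzlim.add ((hconv i).comp hφ.tendsto_atTop)
    simpa [Function.comp_def] using this
  have hδlim : Tendsto (fun n => 1 / (((φ n : ℕ) : ℝ) + 1)) atTop (𝓝 0) :=
    (tendsto_one_div_add_atTop_nhds_zero_nat (𝕜 := ℝ)).comp hφ.tendsto_atTop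
  have hlimit : 0 < ∑ i, f i zs := by
    refine lt_of_lt_of_le hpos (le_of_forall_pos_le_add fun κ hκ => ?_)
    set m : ℝ := ((Fintype.card ι : ℕ) : ℝ) with hm
    have hm0 : 0 ≤ m := by positivity
    have e1 : ∀ᶠ n in atTop, ∀ i, f i (y (φ n) i) < f i zs + κ / (2 * (m + 1)) := by
      rw [eventually_all]
      intro i
      have := hf i zs hzs (f i zs + κ / (2 * (m + 1))) (by
        have : 0 < κ / (2 * (m + 1)) := by positivity
        linarith)
      have ht : Tendsto (fun n => y (φ n) i) atTop (𝓝[Q] zs) :=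
        tendsto_nhdsWithin_iff.2 ⟨hylim i, Eventually.of_forall fun n => hyQ _ i⟩
      exact ht.eventually this
    have e2 : ∀ᶠ n in atTop, 1 / (((φ n : ℕ) : ℝ) + 1) * ‖z0 - z (φ n)‖ < κ / 2 := by
      have : Tendsto (fun n => 1 / (((φ n : ℕ) : ℝ) + 1) * ‖z0 - z (φ n)‖) atTop (𝓝 (0 * ‖z0 - zs‖)) :=
        hδlim.mul (tendsto_const_nhds.sub hzlim).norm
      rw [zero_mul] at this
      exact this.eventually_lt_const (by positivity)
    obtain ⟨n, h1, h2⟩ := (e1.and e2).exists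
    have h3 := hz (φ n) z0 hz0
    have h4 : ∑ i, (f i (y (φ n) i) - ((φ n : ℕ) + 2 : ℝ) * ‖y (φ n) i - z (φ n)‖ ^ 2)
        ≤ ∑ i, (f i zs + κ / (2 * (m + 1))) := by
      refine Finset.sum_le_sum fun i _ => ?_
      have : 0 ≤ ((φ n : ℕ) + 2 : ℝ) * ‖y (φ n) i - z (φ n)‖ ^ 2 := by positivity
      linarith [h1 i]
    rw [Finset.sum_add_distrib, Finset.sum_const, Finset.card_univ, nsmul_eq_mul, ← hm] at h4
    have h5 : m * (κ / (2 * (m + 1))) ≤ κ / 2 := by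
      rw [← mul_div_assoc, div_le_div_iff₀ (by positivity) (by positivity)]
      nlinarith
    linarith
  have hzU := hQU zs hzs hlimit
  have e1 : ∀ᶠ n in atTop, ∀ i, y (φ n) i ∈ U := by
    rw [eventually_all]
    exact fun i => (hylim i).eventually (hU.mem_nhds hzU)
  have e2 : ∀ᶠ n in atTop, 1 / (((φ n : ℕ) : ℝ) + 1) < δ0 := hδlim.eventually_lt_const hδ0
  obtain ⟨n, h1, h2⟩ := (e1.and e2).exists
  exact ⟨y (φ n), q (φ n), A (φ n), fun i => ⟨hyQ _ i, h1 i⟩, (hq _).trans h2.le, hA _, htouch _⟩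
end PDE5

/-- Concavity of the solution operator: if `F` is monotone and concave, `v₁, v₂` are
viscosity subsolutions and `v` a viscosity supersolution of `∂ₜv − F(Dv, D²v) = 0`
with `α v₁(0,·) + (1−α) v₂(0,·) ≤ v(0,·)`, then `α v₁ + (1−α) v₂ ≤ v`. -/
theorem stmt_19 {N : ℕ} (T : ℝ) (hT : 0 < T)
    (F : Euc N → Matrix (Fin N) (Fin N) ℝ → ℝ)
    (hcont : Continuous (fun z : Euc N × Matrix (Fin N) (Fin N) ℝ => F z.1 z.2))
    (C : ℝ) (hC : 0 < C)
    (hhom : ∀ p : Euc N, ∀ Y : Matrix (Fin N) (Fin N) ℝ, Y.IsSymm →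
      ∀ l : ℝ, 0 ≤ l → l * F p Y ≤ C * F (l • p) (l • Y))
    (hlip : ∀ p q : Euc N, ∀ A B : Matrix (Fin N) (Fin N) ℝ, A.IsSymm → B.IsSymm →
      |F p A - F q B| ≤ C * (‖p - q‖ + matOpNorm (A - B)))
    (hmono : ∀ p : Euc N, ∀ A B : Matrix (Fin N) (Fin N) ℝ, A.IsSymm → B.IsSymm →
      (A - B).PosSemidef → F p B ≤ F p A)
    (α : ℝ) (hα : α ∈ Set.Ioo (0 : ℝ) 1)
    (hconc : ∀ p q : Euc N, ∀ A B : Matrix (Fin N) (Fin N) ℝ, A.IsSymm → B.IsSymm →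
      α * F p A + (1 - α) * F q B ≤ F (α • p + (1 - α) • q) (α • A + (1 - α) • B))
    (v₁ v₂ v : ℝ × Euc N → ℝ)
    (husc₁ : UpperSemicontinuousOn v₁ (Set.Icc (0 : ℝ) T ×ˢ (Set.univ : Set (Euc N))))
    (husc₂ : UpperSemicontinuousOn v₂ (Set.Icc (0 : ℝ) T ×ˢ (Set.univ : Set (Euc N))))
    (hlsc : LowerSemicontinuousOn v (Set.Icc (0 : ℝ) T ×ˢ (Set.univ : Set (Euc N))))
    (hgrowth₁ : PolyGrowth T v₁) (hgrowth₂ : PolyGrowth T v₂) (hgrowth : PolyGrowth T v)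
    (hsub₁ : IsViscSubsol' T F v₁) (hsub₂ : IsViscSubsol' T F v₂)
    (hsuper : IsViscSupersol' T F v)
    (hinit_cont : Continuous
      (fun x : Euc N => α * v₁ (0, x) + (1 - α) * v₂ (0, x) - v (0, x)))
    (hinit_nonpos : ∀ x : Euc N, α * v₁ (0, x) + (1 - α) * v₂ (0, x) - v (0, x) ≤ 0) :
    ∀ t ∈ Set.Ico (0 : ℝ) T, ∀ x : Euc N,
      α * v₁ (t, x) + (1 - α) * v₂ (t, x) ≤ v (t, x) := by
  intro t ht x
  by_contra hcon
  push Not at hcon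
  obtain ⟨ht0, htT⟩ := ht
  have ha0 := hα.1
  have ha1 := hα.2
  have htpos : 0 < t := by
    rcases ht0.eq_or_lt with h | h
    · subst h
      have := hinit_nonpos x
      linarith
    · exact h
  -- constants
  set d : ℝ := α * v₁ (t, x) + (1 - α) * v₂ (t, x) - v (t, x) with hd
  have hd0 : 0 < d := by linarith
  set K : ℝ := 2 * C with hK
  set η : ℝ := d / 4 with hη
  have hη0 : 0 < η := by positivity
  set ε : ℝ := d / (4 * (Real.exp (K * t) * (vsPhi x + 1))) with hε
  have hphi := vsPhi_nonneg x
  have hε0 : 0 < ε := by positivity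
  have hεt : ε * Real.exp (K * t) * vsPhi x ≤ d / 4 := by
    have h1 : ε * Real.exp (K * t) * vsPhi x = d / 4 * (vsPhi x / (vsPhi x + 1)) := by
      rw [hε]; field_simp
    rw [h1]
    refine mul_le_of_le_one_right (by positivity) ?_
    rw [div_le_one (by positivity)]; linarith
  -- growth
  obtain ⟨g₁, hg₁m, hg₁o, hg₁⟩ := vs_growth1 T v₁ hgrowth₁
  obtain ⟨g₂, hg₂m, hg₂o, hg₂⟩ := vs_growth1 T v₂ hgrowth₂
  obtain ⟨g₃, hg₃m, hg₃o, hg₃⟩ := vs_growth1 T v hgrowth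
  set g : ℝ → ℝ := fun r => g₁ r + g₂ r + g₃ r with hg
  have hgo : ∀ b > 0, g =o[atTop] fun r => Real.exp (b * r) := fun b hb =>
    ((hg₁o b hb).add (hg₂o b hb)).add (hg₃o b hb)
  have hgm : MonotoneOn g (Ici 0) := (hg₁m.add hg₂m).add hg₃m
  have hgb : ∀ s ∈ Icc (0 : ℝ) T, ∀ z : Euc N,
      α * v₁ (s, z) + (1 - α) * v₂ (s, z) - v (s, z) ≤ g ‖z‖ := by
    intro s hs z
    have b1 := hg₁ s hs z
    have b2 := hg₂ s hs z
    have b3 := (abs_le.1 (hg₃ s hs z)).1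
    have c1 : α * v₁ (s, z) ≤ g₁ ‖z‖ := by
      have := abs_nonneg (v₁ (s, z))
      have := le_abs_self (v₁ (s, z))
      nlinarith
    have c2 : (1 - α) * v₂ (s, z) ≤ g₂ ‖z‖ := by
      have := abs_nonneg (v₂ (s, z))
      have := le_abs_self (v₂ (s, z))
      nlinarith
    simp only [hg]
    linarith
  obtain ⟨R0, hR0, hR0g⟩ := vs_growth2 (N := N) g hgo ε hε0
  set R : ℝ := max R0 (‖x‖ + 1) with hR
  have hRpos : 0 < R := lt_of_lt_of_le hR0 (le_max_left _ _)
  have hxR : ‖x‖ < R := by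
    have := le_max_right R0 (‖x‖ + 1)
    linarith
  set T' : ℝ := (t + T) / 2 with hT'
  have htT' : t < T' := by rw [hT']; linarith
  have hT'T : T' < T := by rw [hT']; linarith
  -- choice of Λ
  obtain ⟨Λ, hΛ0, hΛ⟩ : ∃ Λ : ℝ, 0 < Λ ∧ g R < η * Real.exp (Λ * (T' - t)) := by
    have hpos : 0 < η * (T' - t) := mul_pos hη0 (by linarith)
    refine ⟨(|g R| + 1) / (η * (T' - t)), by positivity, ?_⟩
    have h1 := Real.add_one_le_exp ((|g R| + 1) / (η * (T' - t)) * (T' - t))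
    have h2 : (|g R| + 1) / (η * (T' - t)) * (T' - t) = (|g R| + 1) / η := by
      have : T' - t ≠ 0 := by linarith
      field_simp
    rw [h2] at h1 ⊢
    have h3 : η * ((|g R| + 1) / η + 1) = |g R| + 1 + η := by field_simp
    have h4 := mul_le_mul_of_nonneg_left h1 hη0.le
    have h5 := le_abs_self (g R)
    linarith
  -- the compact set
  set Q : Set (VsH N) := (fun q : ℝ × Euc N => (WithLp.toLp 2 q : VsH N)) ''
    (Icc (0 : ℝ) T' ×ˢ Metric.closedBall (0 : Euc N) R) with hQdef
  have hcl : Continuous (fun q : ℝ × Euc N => (WithLp.toLp 2 q : VsH N)) := by fun_prop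
  have hco : Continuous (fun y : VsH N => (WithLp.ofLp y : ℝ × Euc N)) := by fun_prop
  have hQc : IsCompact Q := (isCompact_Icc.prod (isCompact_closedBall _ _)).image hcl
  have hQmem : ∀ y : VsH N, y ∈ Q ↔ (0 ≤ y.fst ∧ y.fst ≤ T') ∧ ‖y.snd‖ ≤ R := by
    intro y
    constructor
    · rintro ⟨q, ⟨h1, h2⟩, rfl⟩
      exact ⟨h1, by simpa using h2⟩
    · rintro ⟨h1, h2⟩
      exact ⟨WithLp.ofLp y, ⟨h1, by simpa using h2⟩, rfl⟩
  set U : Set (VsH N) := {y | (0 < y.fst ∧ y.fst < T') ∧ ‖y.snd‖ < R} with hUdef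
  have hfc : Continuous (fun y : VsH N => y.fst) := hco.fst
  have hsc : Continuous (fun y : VsH N => y.snd) := hco.snd
  have hUo : IsOpen U :=
    ((isOpen_lt continuous_const hfc).inter (isOpen_lt hfc continuous_const)).inter
      (isOpen_lt hsc.norm continuous_const)
  have hUQ : U ⊆ Q := fun y hy => (hQmem y).2 ⟨⟨hy.1.1.le, hy.1.2.le⟩, hy.2.le⟩
  have hmaps : MapsTo (fun y : VsH N => (WithLp.ofLp y : ℝ × Euc N)) Q
      (Set.Icc (0 : ℝ) T ×ˢ (Set.univ : Set (Euc N))) := fun y hy =>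
    ⟨⟨((hQmem y).1 hy).1.1, ((hQmem y).1 hy).1.2.trans hT'T.le⟩, mem_univ _⟩
  let f : Fin 3 → VsH N → ℝ := ![fun y => α * v₁ (WithLp.ofLp y), fun y => (1 - α) * v₂ (WithLp.ofLp y),
    fun y => - v (WithLp.ofLp y) - vsBeta ε K η Λ t (WithLp.ofLp y)]
  have husc : ∀ i, UpperSemicontinuousOn (f i) Q := by
    have aux : ∀ (c : ℝ) (u : ℝ × Euc N → ℝ), 0 < c →
        UpperSemicontinuousOn u (Set.Icc (0 : ℝ) T ×ˢ (Set.univ : Set (Euc N))) →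
        UpperSemicontinuousOn (fun y : VsH N => c * u (WithLp.ofLp y)) Q := by
      intro c u hc hu y hy r hr
      have h1 : u (WithLp.ofLp y) < r / c := by rw [lt_div_iff₀ hc]; linarith
      have h2 := hu (WithLp.ofLp y) (hmaps hy) _ h1
      have h3 : Tendsto (fun y : VsH N => (WithLp.ofLp y : ℝ × Euc N)) (𝓝[Q] y)
          (𝓝[Set.Icc (0 : ℝ) T ×ˢ (Set.univ : Set (Euc N))] (WithLp.ofLp y)) :=
        hco.continuousWithinAt.tendsto_nhdsWithin hmaps
      filter_upwards [h3.eventually h2] with w hw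
      rw [lt_div_iff₀ hc] at hw
      linarith
    intro i
    fin_cases i
    · exact aux α v₁ ha0 husc₁
    · exact aux (1 - α) v₂ (by linarith) husc₂
    · have h1 : UpperSemicontinuousOn (fun q => - v q) (Set.Icc (0 : ℝ) T ×ˢ (Set.univ : Set (Euc N))) := by
        intro q hq r hr
        have := hlsc q hq (-r) (by linarith)
        filter_upwards [this] with w hw
        linarith
      have h2 := aux 1 _ one_pos h1
      have h3 : UpperSemicontinuousOn
          (fun y : VsH N => - vsBeta ε K η Λ t (WithLp.ofLp y)) Q :=
        ((vsBeta_contDiff ε K η Λ t).continuous.comp hco).neg.continuousOn.upperSemicontinuousOn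
      have h4 := h2.add h3
      have h5 : f 2 = fun y : VsH N => 1 * (- v (WithLp.ofLp y)) + - vsBeta ε K η Λ t (WithLp.ofLp y) := by
        funext y
        simp only [f]
        simp [sub_eq_add_neg]
      show UpperSemicontinuousOn (f 2) Q
      rw [h5]
      exact h4
  have hfsum : ∀ y, ∑ i, f i y = α * v₁ (WithLp.ofLp y) + (1 - α) * v₂ (WithLp.ofLp y)
      - v (WithLp.ofLp y) - vsBeta ε K η Λ t (WithLp.ofLp y) := by
    intro y
    rw [Fin.sum_univ_three]
    simp only [f, Matrix.cons_val_zero, Matrix.cons_val_one, Matrix.cons_val]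
    ring
  have hz0 : (WithLp.toLp 2 (t, x) : VsH N) ∈ Q :=
    (hQmem _).2 ⟨⟨ht0, htT'.le⟩, hxR.le⟩
  have hpos0 : 0 < ∑ i, f i (WithLp.toLp 2 (t, x)) := by
    rw [hfsum]
    simp only [vsBeta, sub_self, mul_zero, Real.exp_zero, mul_one]
    linarith
  have hQU : ∀ z ∈ Q, 0 < ∑ i, f i z → z ∈ U := by
    intro z hz hzpos
    rw [hfsum] at hzpos
    obtain ⟨⟨z1, z2⟩, z3⟩ := (hQmem z).1 hz
    have hb := hgb z.fst ⟨z1, z2.trans hT'T.le⟩ z.snd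
    have hval : vsBeta ε K η Λ t (WithLp.ofLp z)
      = ε * Real.exp (K * z.fst) * vsPhi z.snd + η * Real.exp (Λ * (z.fst - t)) := rfl
    rw [hval] at hzpos
    change 0 < α * v₁ (z.fst, z.snd) + (1 - α) * v₂ (z.fst, z.snd) - v (z.fst, z.snd) - _ at hzpos
    have p1 : ε * vsPhi z.snd ≤ ε * Real.exp (K * z.fst) * vsPhi z.snd := by
      have h1 : 1 ≤ Real.exp (K * z.fst) := Real.one_le_exp (by positivity)
      have h2 := mul_nonneg hε0.le (vsPhi_nonneg z.snd)
      nlinarith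
    have p2 : 0 < η * Real.exp (Λ * (z.fst - t)) := by positivity
    have p3 : 0 ≤ ε * vsPhi z.snd := mul_nonneg hε0.le (vsPhi_nonneg z.snd)
    refine ⟨⟨?_, ?_⟩, ?_⟩
    · rcases z1.eq_or_lt with h | h
      · have := hinit_nonpos z.snd
        rw [← h] at hzpos p1 p2
        linarith
      · exact h
    · rcases z2.eq_or_lt with h | h
      · have h1 : g ‖z.snd‖ ≤ g R := hgm (norm_nonneg _) hRpos.le z3
        rw [h] at hzpos hb p1
        linarith
      · exact h
    · by_contra hnot
      push Not at hnot
      have := hR0g z.snd ((le_max_left _ _).trans hnot)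
      linarith
  -- apply the theorem on sums
  set G0 : ℝ := Λ * (η * Real.exp (-(Λ * t))) with hG0
  have hG0pos : 0 < G0 := by positivity
  obtain ⟨y, q, A, hy, hq, hA, htouch⟩ := vs_compact Q hQc f husc _ hz0 hpos0 U hUo hQU
    (G0 / (4 * (1 + C))) (by positivity)
  have hQn : ∀ i, Q ∈ 𝓝 (y i) := fun i => mem_of_superset (hUo.mem_nhds (hy i).2) hUQ
  have hyT : ∀ i, (y i).fst ∈ Ioo 0 T := fun i => ⟨(hy i).2.1.1, (hy i).2.1.2.trans hT'T⟩
  set e : ℝ := G0 / (12 * C) with he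
  have he0 : 0 < e := by positivity
  have k0 := vs_sub T F v₁ hsub₁ α ha0 Q (y 0) (q 0) (A 0) (hQn 0) (hyT 0) (htouch 0) e he0
  have k1 := vs_sub T F v₂ hsub₂ (1 - α) (by linarith) Q (y 1) (q 1) (A 1) (hQn 1) (hyT 1)
    (htouch 1) e he0
  have k2 := vs_super T F v hsuper ε K η Λ t Q (y 2) (q 2) (A 2) (hQn 2) (hyT 2)
    (htouch 2) e he0
  have k3 := vs_ineq F C hC hlip hmono α hα hconc q A _ hq hA e he0
    (ε * Real.exp (K * (y 2).fst)) (Λ * (η * Real.exp (Λ * ((y 2).fst - t)))) (by positivity)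
    (y 2).snd k0 k1 k2
  have k4 : G0 ≤ Λ * (η * Real.exp (Λ * ((y 2).fst - t))) := by
    rw [hG0]
    have h1 : -(Λ * t) ≤ Λ * ((y 2).fst - t) := by
      have := mul_pos hΛ0 (hyT 2).1
      linarith
    have h2 := Real.exp_le_exp.2 h1
    gcongr
  have k5 : (1 + C) * (G0 / (4 * (1 + C))) = G0 / 4 := by field_simp
  have k6 : 3 * C * e = G0 / 4 := by rw [he]; field_simp; norm_num
  linarith
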